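/- arXiv:2605.08865 — 2 statements merged into one kernel-verified Lean document; each statement's English description precedes it below -/
import Mathlib

section
/- Let σ ∈ (1/2, 1) be fixed. As X → ∞, ∑_{p ≤ X, p prime} (1 − (p/X)^{σ}) p^{−σ} = ( σ/(1−σ) + o(1) ) · X^{1−σ} / log X; that is, the ratio of this sum to X^{1−σ}/log X tends to σ/(1−σ) as X → ∞. -/
open MeasureTheory Filter Topology FourierTransform
open scoped ContDiff

lemma norm_mul_cexp_neg_le {f : ℝ → ℂ} {C : ℝ} (hb : ∀ u, ‖f u‖ ≤ C) (h0 : ∀ u < 0, f u = 0)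
    (z : ℂ) (u : ℝ) : ‖f u * Complex.exp (-(z * u))‖ ≤
      (Set.Ici (0 : ℝ)).indicator (fun u ↦ C * Real.exp (-z.re * u)) u := by
  by_cases hu : 0 ≤ u
  · rw [Set.indicator_of_mem (Set.mem_Ici.2 hu), norm_mul, Complex.norm_exp]
    have : (-(z * u)).re = -z.re * u := by simp
    rw [this]
    gcongr
    exact hb u
  · rw [Set.indicator_of_notMem (by simpa using hu), h0 u (not_le.1 hu)]
    simp

lemma integrable_indicator_exp_neg (C : ℝ) {x : ℝ} (hx : 0 < x) :
    Integrable ((Set.Ici (0 : ℝ)).indicator fun u ↦ C * Real.exp (-x * u)) := by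
  rw [integrable_indicator_iff measurableSet_Ici, integrableOn_Ici_iff_integrableOn_Ioi]
  exact (exp_neg_integrableOn_Ioi 0 hx).const_mul C

lemma integrable_mul_cexp_neg {f : ℝ → ℂ} {C : ℝ} (hm : Measurable f) (hb : ∀ u, ‖f u‖ ≤ C)
    (h0 : ∀ u < 0, f u = 0) {z : ℂ} (hz : 0 < z.re) :
    Integrable (fun u : ℝ ↦ f u * Complex.exp (-(z * u))) :=
  (integrable_indicator_exp_neg C hz).mono' (hm.mul (by fun_prop)).aestronglyMeasurable
    (ae_of_all _ (norm_mul_cexp_neg_le hb h0 z))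

/-- `f` is a bounded measurable function supported on `[0, ∞)` whose Laplace transform extends to
`G`, continuous on the closed right half-plane. -/
structure HasLaplaceExtension (f : ℝ → ℂ) (C : ℝ) (G : ℂ → ℂ) : Prop where
  measurable : Measurable f
  bound : ∀ u, ‖f u‖ ≤ C
  eq_zero : ∀ u < 0, f u = 0
  continuousOn : ContinuousOn G {z | 0 ≤ z.re}
  integral_eq : ∀ z : ℂ, 0 < z.re → ∫ u : ℝ, f u * Complex.exp (-(z * u)) = G z

namespace HasLaplaceExtension

variable {f : ℝ → ℂ} {C : ℝ} {G : ℂ → ℂ}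

lemma integrable_mul_exp (hf : HasLaplaceExtension f C G) {z : ℂ} (hz : 0 < z.re) :
    Integrable (fun u : ℝ ↦ f u * Complex.exp (-(z * u))) :=
  integrable_mul_cexp_neg hf.measurable hf.bound hf.eq_zero hz

lemma integral_mul_fourier_of_pos (hf : HasLaplaceExtension f C G) {φ : ℝ → ℂ} (hφ : Continuous φ)
    (hφc : HasCompactSupport φ) {ε : ℝ} (hε : 0 < ε) (v : ℝ) :
    ∫ u : ℝ, f u * Complex.exp (-(ε * u)) * 𝓕 φ (u - v) =
      ∫ t : ℝ, Complex.exp (↑(2 * Real.pi * t * v) * Complex.I) *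
        (φ t * G (ε + 2 * Real.pi * t * Complex.I)) := by
  have hφi : Integrable φ := hφ.integrable_of_hasCompactSupport hφc
  have hfi := hf.integrable_mul_exp (z := ε) (by simpa using hε)
  have hint : Integrable (Function.uncurry fun u t : ℝ ↦ f u * Complex.exp (-(ε * u)) *
      (Complex.exp (↑(-2 * Real.pi * t * (u - v)) * Complex.I) • φ t)) (volume.prod volume) := by
    refine (hfi.mul_prod hφi).mono ?_ (ae_of_all _ fun x ↦ ?_)
    · have := hf.measurable
      have := hφ.measurable
      refine Measurable.aestronglyMeasurable ?_
      simp only [Function.uncurry_def]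
      fun_prop
    · simp only [Function.uncurry, norm_mul, smul_eq_mul, Complex.norm_exp_ofReal_mul_I, one_mul]
      exact le_rfl
  calc _ = ∫ u : ℝ, ∫ t : ℝ, f u * Complex.exp (-(ε * u)) *
        (Complex.exp (↑(-2 * Real.pi * t * (u - v)) * Complex.I) • φ t) := by
        simp_rw [Real.fourier_real_eq_integral_exp_smul, ← integral_const_mul]
    _ = _ := by
        rw [integral_integral_swap hint]
        refine integral_congr_ae (ae_of_all _ fun t ↦ ?_)
        simp only
        rw [← hf.integral_eq _ (by simpa using hε), ← mul_assoc, ← integral_const_mul]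
        refine integral_congr_ae (ae_of_all _ fun u ↦ ?_)
        simp only [smul_eq_mul]
        have : Complex.exp (-(ε * u)) * Complex.exp (↑(-2 * Real.pi * t * (u - v)) * Complex.I)
            = Complex.exp (↑(2 * Real.pi * t * v) * Complex.I) *
              Complex.exp (-((ε + 2 * Real.pi * t * Complex.I) * u)) := by
          rw [← Complex.exp_add, ← Complex.exp_add]
          congr 1
          push_cast
          ring
        linear_combination (f u * φ t) * this

lemma integral_mul_fourier (hf : HasLaplaceExtension f C G) {φ : ℝ → ℂ} (hφ : Continuous φ)
    (hφc : HasCompactSupport φ) (hφF : Integrable (𝓕 φ)) (v : ℝ) :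
    ∫ u : ℝ, f u * 𝓕 φ (u - v) =
      𝓕 (fun t : ℝ ↦ φ t * G (2 * Real.pi * t * Complex.I)) (-v) := by
  have hlim : Tendsto (fun ε : ℝ ↦ ε) (𝓝[>] 0) (𝓝 0) := tendsto_id.mono_left nhdsWithin_le_nhds
  have hC : 0 ≤ C := (norm_nonneg _).trans (hf.bound 0)
  have hL : Tendsto (fun ε : ℝ ↦ ∫ u : ℝ, f u * Complex.exp (-(ε * u)) * 𝓕 φ (u - v)) (𝓝[>] 0)
      (𝓝 (∫ u : ℝ, f u * 𝓕 φ (u - v))) := by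
    have hF : Integrable fun u ↦ 𝓕 φ (u - v) := hφF.comp_sub_right v
    refine tendsto_integral_filter_of_dominated_convergence (fun u ↦ C * ‖𝓕 φ (u - v)‖) ?_ ?_
      (hF.norm.const_mul C) ?_
    · refine Eventually.of_forall fun ε ↦ ?_
      exact (hf.measurable.mul (by fun_prop)).aestronglyMeasurable.mul hF.aestronglyMeasurable
    · filter_upwards [self_mem_nhdsWithin] with ε hε
      refine ae_of_all _ fun u ↦ ?_
      rw [norm_mul]
      gcongr
      by_cases hu : 0 ≤ u
      · rw [norm_mul, Complex.norm_exp]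
        have : Real.exp (-((ε : ℂ) * u)).re ≤ 1 := by
          rw [Real.exp_le_one_iff]
          have : 0 ≤ ε * u := mul_nonneg (le_of_lt hε) hu
          simpa using this
        simpa using mul_le_mul (hf.bound u) this (Real.exp_pos _).le hC
      · simpa [hf.eq_zero u (not_le.1 hu)] using hC
    · refine ae_of_all _ fun u ↦ ?_
      have : Continuous fun ε : ℝ ↦ f u * Complex.exp (-(ε * u)) * 𝓕 φ (u - v) := by fun_prop
      simpa using (this.tendsto 0).mono_left nhdsWithin_le_nhds
  have hR : Tendsto (fun ε : ℝ ↦ ∫ t : ℝ, Complex.exp (↑(2 * Real.pi * t * v) * Complex.I) *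
        (φ t * G (ε + 2 * Real.pi * t * Complex.I))) (𝓝[>] 0)
      (𝓝 (∫ t : ℝ, Complex.exp (↑(2 * Real.pi * t * v) * Complex.I) *
        (φ t * G (2 * Real.pi * t * Complex.I)))) := by
    have hG : ContinuousOn (fun p : ℝ × ℝ ↦ G (p.1 + 2 * Real.pi * p.2 * Complex.I))
        (Set.Ici 0 ×ˢ Set.univ) := by
      refine hf.continuousOn.comp (Continuous.continuousOn (by fun_prop)) fun p hp ↦ ?_
      simpa using hp.1
    obtain ⟨M, hM⟩ := ((isCompact_Icc (a := (0 : ℝ)) (b := 1)).prod hφc).exists_bound_of_continuousOn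
      (hG.mono (Set.prod_mono Set.Icc_subset_Ici_self (Set.subset_univ _)))
    have hslice (ε : ℝ) (hε : 0 ≤ ε) : Continuous fun t : ℝ ↦ G (ε + 2 * Real.pi * t * Complex.I) :=
      hG.comp_continuous (f := fun t : ℝ ↦ (ε, t)) (by fun_prop) fun t ↦ ⟨hε, trivial⟩
    refine tendsto_integral_filter_of_dominated_convergence (fun t ↦ ‖φ t‖ * M) ?_ ?_
      ((hφ.integrable_of_hasCompactSupport hφc).norm.mul_const M) ?_
    · filter_upwards [self_mem_nhdsWithin] with ε hε
      have := hslice ε (le_of_lt hε)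
      exact (Continuous.mul (by fun_prop) (hφ.mul this)).aestronglyMeasurable
    · filter_upwards [Ioc_mem_nhdsGT zero_lt_one] with ε hε
      refine ae_of_all _ fun t ↦ ?_
      rw [norm_mul, Complex.norm_exp_ofReal_mul_I, one_mul, norm_mul]
      by_cases ht : t ∈ tsupport φ
      · gcongr
        exact hM (ε, t) ⟨⟨hε.1.le, hε.2⟩, ht⟩
      · simp [image_eq_zero_of_notMem_tsupport ht]
    · refine ae_of_all _ fun t ↦ ?_
      refine Tendsto.const_mul _ (Tendsto.const_mul _ ?_)
      have h0 := (hG.comp (f := fun ε : ℝ ↦ (ε, t)) (s := Set.Ici 0) (by fun_prop)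
        fun ε hε ↦ ⟨hε, trivial⟩) 0 (Set.self_mem_Ici)
      simpa [Function.comp_def] using h0.tendsto.mono_left (nhdsWithin_mono _ Set.Ioi_subset_Ici_self)
  have := tendsto_nhds_unique (hL.congr' ?_) hR
  · rw [this, Real.fourier_real_eq_integral_exp_smul]
    refine integral_congr_ae (ae_of_all _ fun t ↦ ?_)
    simp only [smul_eq_mul]
    congr 4
    ring
  · filter_upwards [self_mem_nhdsWithin] with ε hε
    exact hf.integral_mul_fourier_of_pos hφ hφc hε v

lemma tendsto_integral_mul_fourier (hf : HasLaplaceExtension f C G) {φ : ℝ → ℂ} (hφ : Continuous φ)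
    (hφc : HasCompactSupport φ) (hφF : Integrable (𝓕 φ)) :
    Tendsto (fun v ↦ ∫ u : ℝ, f u * 𝓕 φ (u - v)) atTop (𝓝 0) := by
  simp_rw [hf.integral_mul_fourier hφ hφc hφF]
  exact (Real.zero_at_infty_fourier _).comp (tendsto_neg_atTop_atBot.mono_right atBot_le_cocompact)

lemma comp_div (hf : HasLaplaceExtension f C G) {r : ℝ} (hr : 0 < r) :
    HasLaplaceExtension (fun u ↦ f (u / r)) C (fun z ↦ r * G (r * z)) where
  measurable := hf.measurable.comp (by fun_prop)
  bound u := hf.bound _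
  eq_zero u hu := hf.eq_zero _ (div_neg_of_neg_of_pos hu hr)
  continuousOn := by
    refine continuousOn_const.mul (hf.continuousOn.comp (by fun_prop) fun z hz ↦ ?_)
    simpa using mul_nonneg hr.le hz
  integral_eq z hz := by
    rw [← hf.integral_eq (r * z) (by simpa using mul_pos hr hz)]
    have := Measure.integral_comp_div (fun u : ℝ ↦ f u * Complex.exp (-(r * z * u))) r
    rw [abs_of_pos hr] at this
    rw [← Complex.real_smul, ← this]
    refine integral_congr_ae (ae_of_all _ fun u ↦ ?_)
    have : (r : ℂ) ≠ 0 := by exact_mod_cast hr.ne'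
    simp only
    congr 3
    push_cast
    field_simp

/-- A smooth compactly supported function with value `1` at the origin. -/
lemma exists_schwartz_bump : ∃ φ : SchwartzMap ℝ ℂ, HasCompactSupport φ ∧ φ 0 = 1 := by
  let b : ContDiffBump (0 : ℝ) := ⟨1, 2, one_pos, one_lt_two⟩
  have hb : HasCompactSupport fun x ↦ (b x : ℂ) :=
    b.hasCompactSupport.comp_left (g := fun x : ℝ ↦ (x : ℂ)) rfl
  have hs : ContDiff ℝ ∞ fun x ↦ (b x : ℂ) := Complex.ofRealCLM.contDiff.comp b.contDiff
  refine ⟨hb.toSchwartzMap hs, hb, ?_⟩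
  have : b 0 = 1 := b.one_of_mem_closedBall (by simp [b])
  exact congrArg Complex.ofReal this

/-- Tauberian theorem: a Lipschitz function whose Laplace transform extends continuously to the
closed right half-plane tends to zero. -/
theorem tendsto_zero (hf : HasLaplaceExtension f C G) {L : ℝ} (hL : 0 ≤ L)
    (hlip : ∀ u v, ‖f u - f v‖ ≤ L * |u - v|) : Tendsto f atTop (𝓝 0) := by
  obtain ⟨φ, hφc, hφ0⟩ := exists_schwartz_bump
  have hFφ : Integrable (𝓕 (φ : ℝ → ℂ)) := by
    rw [← SchwartzMap.fourier_coe]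
    exact (𝓕 φ).integrable
  have hmom : Integrable fun w : ℝ ↦ |w| * ‖𝓕 (φ : ℝ → ℂ) w‖ := by
    rw [← SchwartzMap.fourier_coe]
    simpa using SchwartzMap.integrable_pow_mul volume (𝓕 φ) 1
  have hone : ∫ w, 𝓕 (φ : ℝ → ℂ) w = 1 := by
    have h := congrFun (φ.continuous.fourierInv_fourier_eq φ.integrable hFφ) 0
    rw [Real.fourierInv_eq] at h
    simpa [hφ0] using h
  set M := ∫ w : ℝ, |w| * ‖𝓕 (φ : ℝ → ℂ) w‖ with hM
  have hM0 : 0 ≤ M := integral_nonneg fun w ↦ by positivity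
  have key {r : ℝ} (hr : 0 < r) (v : ℝ) :
      ‖f (v / r) - ∫ u : ℝ, f (u / r) * 𝓕 (φ : ℝ → ℂ) (u - v)‖ ≤ L / r * M := by
    have hFv := hFφ.comp_sub_right v
    have h1 : f (v / r) = ∫ u : ℝ, f (v / r) * 𝓕 (φ : ℝ → ℂ) (u - v) := by
      rw [integral_const_mul, integral_sub_right_eq_self (fun w ↦ 𝓕 (φ : ℝ → ℂ) w) v, hone, mul_one]
    have hi : Integrable fun u : ℝ ↦ f (u / r) * 𝓕 (φ : ℝ → ℂ) (u - v) :=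
      hFv.bdd_mul (hf.comp_div hr).measurable.aestronglyMeasurable
        (ae_of_all _ (hf.comp_div hr).bound)
    have h2 : M = ∫ u : ℝ, |u - v| * ‖𝓕 (φ : ℝ → ℂ) (u - v)‖ :=
      (integral_sub_right_eq_self (fun w ↦ |w| * ‖𝓕 (φ : ℝ → ℂ) w‖) v).symm
    rw [h2, ← integral_const_mul]
    nth_rewrite 1 [h1]
    rw [← integral_sub (hFv.const_mul _) hi]
    refine norm_integral_le_of_norm_le ((hmom.comp_sub_right v).const_mul _) (ae_of_all _ fun u ↦ ?_)
    rw [← sub_mul, norm_mul, ← mul_assoc]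
    gcongr
    refine (hlip _ _).trans_eq ?_
    rw [← sub_div, abs_div, abs_of_pos hr, abs_sub_comm]
    ring
  rw [Metric.tendsto_atTop]
  intro ε hε
  obtain ⟨r, hr, hrε⟩ : ∃ r : ℝ, 0 < r ∧ L / r * M < ε / 2 := by
    refine ⟨2 * (L * M + 1) / ε, by positivity, ?_⟩
    rw [div_div_eq_mul_div, div_mul_eq_mul_div, div_lt_div_iff₀ (by positivity) (by positivity)]
    nlinarith
  obtain ⟨N, hN⟩ := Metric.tendsto_atTop.1
    ((hf.comp_div hr).tendsto_integral_mul_fourier φ.continuous hφc hFφ) (ε / 2) (by positivity)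
  refine ⟨N / r, fun u hu ↦ ?_⟩
  have h1 := key hr (r * u)
  have h2 := hN (r * u) (by rwa [ge_iff_le, div_le_iff₀' hr] at hu)
  rw [mul_div_cancel_left₀ _ hr.ne'] at h1
  rw [dist_zero_right] at h2 ⊢
  have h3 := norm_sub_norm_le (f u) (∫ w : ℝ, f (w / r) * 𝓕 (φ : ℝ → ℂ) (w - r * u))
  linarith

lemma intervalIntegrable (hf : HasLaplaceExtension f C G) (a b : ℝ) :
    IntervalIntegrable f volume a b :=
  (intervalIntegrable_const (c := C)).mono_fun hf.measurable.aestronglyMeasurable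
    (ae_of_all _ fun u ↦ (hf.bound u).trans (le_abs_self C))

lemma norm_integral_comp_sub_le (hf : HasLaplaceExtension f C G) (δ u v : ℝ) :
    ‖(∫ w in (0 : ℝ)..δ, f (u - w)) - ∫ w in (0 : ℝ)..δ, f (v - w)‖ ≤ 2 * C * |u - v| := by
  rw [intervalIntegral.integral_comp_sub_left, intervalIntegral.integral_comp_sub_left,
    intervalIntegral.integral_interval_sub_interval_comm (hf.intervalIntegrable _ _)
      (hf.intervalIntegrable _ _) (hf.intervalIntegrable _ _)]
  have h1 := intervalIntegral.norm_integral_le_of_norm_le_const (a := u - δ) (b := v - δ)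
    fun w _ ↦ hf.bound w
  have h2 := intervalIntegral.norm_integral_le_of_norm_le_const (a := u - 0) (b := v - 0)
    fun w _ ↦ hf.bound w
  rw [show v - δ - (u - δ) = -(u - v) by ring, abs_neg] at h1
  rw [show v - 0 - (u - 0) = -(u - v) by ring, abs_neg] at h2
  refine (norm_sub_le _ _).trans ?_
  linarith

lemma movingIntegral (hf : HasLaplaceExtension f C G) {δ : ℝ} (hδ : 0 ≤ δ) :
    HasLaplaceExtension (fun u ↦ ∫ w in (0 : ℝ)..δ, f (u - w)) (C * δ)
      (fun z ↦ (∫ w in (0 : ℝ)..δ, Complex.exp (-(z * w))) * G z) where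
  measurable := by
    refine Continuous.measurable (LipschitzWith.continuous (K := (2 * C).toNNReal) ?_)
    refine LipschitzWith.of_dist_le' fun u v ↦ ?_
    rw [dist_eq_norm, Real.dist_eq]
    exact hf.norm_integral_comp_sub_le δ u v
  bound u := by
    simpa [abs_of_nonneg hδ] using
      intervalIntegral.norm_integral_le_of_norm_le_const (a := 0) (b := δ)
        fun w _ ↦ hf.bound (u - w)
  eq_zero u hu := by
    rw [intervalIntegral.integral_congr (g := fun _ ↦ 0), intervalIntegral.integral_zero]
    intro w hw
    rw [Set.uIcc_of_le hδ] at hw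
    exact hf.eq_zero _ (by linarith [hw.1])
  continuousOn := by
    refine ContinuousOn.mul (Continuous.continuousOn ?_) hf.continuousOn
    exact intervalIntegral.continuous_parametric_intervalIntegral_of_continuous' (by fun_prop) _ _
  integral_eq z hz := by
    have hint : Integrable (Function.uncurry fun w u : ℝ ↦ f (u - w) * Complex.exp (-(z * u)))
        ((volume.restrict (Set.Ioc 0 δ)).prod volume) := by
      refine ((integrable_indicator_exp_neg C hz).comp_snd (volume.restrict (Set.Ioc 0 δ))).mono' ?_ ?_
      · have := hf.measurable
        refine Measurable.aestronglyMeasurable ?_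
        simp only [Function.uncurry_def]
        fun_prop
      · filter_upwards [Measure.quasiMeasurePreserving_fst.ae
          (ae_restrict_mem (μ := volume) (measurableSet_Ioc (a := (0 : ℝ)) (b := δ)))] with x hx
        exact norm_mul_cexp_neg_le (f := fun u ↦ f (u - x.1)) (fun u ↦ hf.bound _)
          (fun u hu ↦ hf.eq_zero _ (by linarith [hx.1])) z x.2
    simp_rw [intervalIntegral.integral_of_le hδ, ← integral_mul_const]
    rw [← integral_integral_swap hint]
    refine integral_congr_ae (ae_of_all _ fun w ↦ ?_)
    simp only
    rw [← hf.integral_eq z hz, ← integral_const_mul,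
      ← integral_sub_right_eq_self (fun u : ℝ ↦ Complex.exp (-(z * w)) *
        (f u * Complex.exp (-(z * u)))) w]
    refine integral_congr_ae (ae_of_all _ fun u ↦ ?_)
    simp only
    rw [mul_left_comm, ← Complex.exp_add]
    congr 2
    push_cast
    ring

end HasLaplaceExtension

namespace Chebyshev
open ArithmeticFunction

/-- The normalised error `ψ(e ^ u) e ^ (-u) - 1` for `u ≥ 0`, extended by zero. -/
noncomputable def psiError : ℝ → ℝ :=
  (Set.Ici 0).indicator fun u ↦ psi (Real.exp u) * Real.exp (-u) - 1

lemma psi_exp_mul_exp_neg_nonneg (u : ℝ) : 0 ≤ psi (Real.exp u) * Real.exp (-u) :=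
  mul_nonneg (psi_nonneg _) (Real.exp_pos _).le

lemma psi_exp_mul_exp_neg_le (u : ℝ) :
    psi (Real.exp u) * Real.exp (-u) ≤ Real.log 4 + 4 := by
  rw [Real.exp_neg, ← div_eq_mul_inv, div_le_iff₀ (Real.exp_pos _)]
  exact psi_le_const_mul_self (Real.exp_pos _).le

lemma log_four_nonneg : 0 ≤ Real.log 4 := Real.log_nonneg (by norm_num)

lemma measurable_psi_exp_mul_exp_neg : Measurable fun u ↦ psi (Real.exp u) * Real.exp (-u) :=
  (psi_mono.measurable.comp Real.measurable_exp).mul (by fun_prop)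

lemma measurable_psiError : Measurable psiError :=
  (measurable_psi_exp_mul_exp_neg.sub measurable_const).indicator measurableSet_Ici

lemma LSeries_vonMangoldt_eq_mul_integral_psi {s : ℂ} (hs : 1 < s.re) :
    LSeries (fun n ↦ (vonMangoldt n : ℂ)) s =
      s * ∫ t in Set.Ioi (1 : ℝ), (psi t : ℂ) * (t : ℂ) ^ (-(s + 1)) := by
  have hIcc (n : ℕ) : ∑ k ∈ Finset.Icc 1 n, vonMangoldt k = psi n := by
    rw [psi, Nat.floor_natCast]
    rfl
  rw [LSeries_eq_mul_integral_of_nonneg vonMangoldt zero_le_one hs ?_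
    fun _ ↦ vonMangoldt_nonneg]
  · congr 2 with t
    rw [psi, Complex.ofReal_sum]
    rfl
  · refine Asymptotics.IsBigO.of_bound (Real.log 4 + 4) (Eventually.of_forall fun n ↦ ?_)
    rw [hIcc, Real.rpow_one, Real.norm_of_nonneg (psi_nonneg _), Real.norm_of_nonneg n.cast_nonneg]
    exact psi_le_const_mul_self n.cast_nonneg

lemma integral_psi_exp {z : ℂ} :
    ∫ u in Set.Ioi (0 : ℝ), ((psi (Real.exp u) * Real.exp (-u) : ℝ) : ℂ) * Complex.exp (-(z * u)) =
      ∫ t in Set.Ioi (1 : ℝ), (psi t : ℂ) * (t : ℂ) ^ (-(1 + z + 1)) := by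
  have himg : Real.exp '' Set.Ioi 0 = Set.Ioi 1 := by
    ext x
    constructor
    · rintro ⟨u, hu, rfl⟩
      exact Real.one_lt_exp_iff.2 hu
    · intro hx
      exact ⟨Real.log x, Real.log_pos hx, Real.exp_log (zero_lt_one.trans hx)⟩
  rw [← himg, integral_image_eq_integral_abs_deriv_smul measurableSet_Ioi
    (fun x _ ↦ (Real.hasDerivAt_exp x).hasDerivWithinAt) Real.exp_injective.injOn]
  refine integral_congr_ae (ae_of_all _ fun u ↦ ?_)
  simp only
  rw [abs_of_pos (Real.exp_pos u), Complex.real_smul, Complex.cpow_def_of_ne_zero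
    (by exact_mod_cast (Real.exp_pos u).ne'), ← Complex.ofReal_log (Real.exp_pos u).le, Real.log_exp]
  push_cast
  rw [mul_assoc, mul_left_comm (Complex.exp u), ← Complex.exp_add, ← Complex.exp_add]
  congr 2
  ring

/-- The continuous extension of `-ζ'/ζ(s) - 1 / (s - 1)` to the closed half-plane `1 ≤ re s`. -/
lemma exists_continuousOn_LSeries_vonMangoldt :
    ∃ A : ℂ → ℂ, ContinuousOn A {s | 1 ≤ s.re} ∧ ∀ s : ℂ, 1 < s.re →
      A s = LSeries (fun n ↦ (vonMangoldt n : ℂ)) s - 1 / (s - 1) := by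
  refine ⟨vonMangoldt.LFunctionResidueClassAux (1 : ZMod 1),
    vonMangoldt.continuousOn_LFunctionResidueClassAux _, fun s hs ↦ ?_⟩
  rw [vonMangoldt.eqOn_LFunctionResidueClassAux isUnit_one hs]
  have : vonMangoldt.residueClass (1 : ZMod 1) = vonMangoldt := by
    ext n
    exact Set.indicator_of_mem (s := {n : ℕ | (n : ZMod 1) = 1}) (Subsingleton.elim _ _) _
  simp [this]

lemma exists_hasLaplaceExtension_psiError :
    ∃ G, HasLaplaceExtension (fun u ↦ (psiError u : ℂ)) (Real.log 4 + 5) G := by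
  obtain ⟨A, hA, hAeq⟩ := exists_continuousOn_LSeries_vonMangoldt
  refine ⟨fun z ↦ (A (1 + z) - 1) / (1 + z), ?_, fun u ↦ ?_, fun u hu ↦ ?_, ?_, fun z hz ↦ ?_⟩
  · exact Complex.measurable_ofReal.comp measurable_psiError
  · rw [Complex.norm_real, Real.norm_eq_abs, psiError]
    have h1 := psi_exp_mul_exp_neg_nonneg u
    have h2 := psi_exp_mul_exp_neg_le u
    have h3 := log_four_nonneg
    by_cases hu : u ∈ Set.Ici (0 : ℝ)
    · rw [Set.indicator_of_mem hu, abs_le]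
      constructor <;> linarith
    · rw [Set.indicator_of_notMem hu, abs_zero]
      linarith
  · rw [psiError, Set.indicator_of_notMem (by simpa using hu), Complex.ofReal_zero]
  · refine ContinuousOn.div ((hA.comp (by fun_prop) fun z hz ↦ ?_).sub continuousOn_const)
      (by fun_prop) fun z hz h ↦ ?_
    · simpa using hz
    · have := congrArg Complex.re h
      simp only [Complex.add_re, Complex.one_re, Complex.zero_re] at this
      linarith [show 0 ≤ z.re from hz]
  · have hs : 1 < (1 + z).re := by simpa using hz
    have hz0 : z ≠ 0 := fun h ↦ by simp [h] at hz
    have hs0 : 1 + z ≠ 0 := fun h ↦ by rw [h, Complex.zero_re] at hs; linarith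
    have hL := LSeries_vonMangoldt_eq_mul_integral_psi hs
    rw [← integral_psi_exp] at hL
    rw [hAeq _ hs, hL]
    have hψ : IntegrableOn (fun u : ℝ ↦ ((psi (Real.exp u) * Real.exp (-u) : ℝ) : ℂ) *
        Complex.exp (-(z * u))) (Set.Ioi 0) := by
      have hm : Measurable ((Set.Ioi (0 : ℝ)).indicator
          fun u ↦ ((psi (Real.exp u) * Real.exp (-u) : ℝ) : ℂ)) :=
        (Complex.measurable_ofReal.comp measurable_psi_exp_mul_exp_neg).indicator measurableSet_Ioi
      refine IntegrableOn.congr_fun (integrable_mul_cexp_neg (C := Real.log 4 + 4) hm (fun u ↦ ?_)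
        (fun u hu ↦ ?_) hz).integrableOn (fun u hu ↦ ?_) measurableSet_Ioi
      · refine (norm_indicator_le_norm_self _ _).trans ?_
        rw [Complex.norm_real, Real.norm_of_nonneg (psi_exp_mul_exp_neg_nonneg u)]
        exact psi_exp_mul_exp_neg_le u
      · exact Set.indicator_of_notMem (by simpa using hu.le) _
      · simp only [Set.indicator_of_mem hu]
    have hexp : IntegrableOn (fun u : ℝ ↦ Complex.exp (-(z * u))) (Set.Ioi 0) := by
      simpa using integrableOn_exp_mul_complex_Ioi (a := -z) (by simpa using hz) 0
    have hexp' : ∫ u in Set.Ioi (0 : ℝ), Complex.exp (-(z * u)) = 1 / z := by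
      simpa using integral_exp_mul_complex_Ioi (a := -z) (by simpa using hz) 0
    have : ∫ u : ℝ, (psiError u : ℂ) * Complex.exp (-(z * u)) =
        ∫ u in Set.Ioi (0 : ℝ), (((psi (Real.exp u) * Real.exp (-u) : ℝ) : ℂ) *
          Complex.exp (-(z * u)) - Complex.exp (-(z * u))) := by
      rw [← integral_Ici_eq_integral_Ioi, ← integral_indicator measurableSet_Ici]
      refine integral_congr_ae (ae_of_all _ fun u ↦ ?_)
      by_cases hu : u ∈ Set.Ici (0 : ℝ)
      · simp only [psiError, Set.indicator_of_mem hu]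
        push_cast
        ring
      · simp only [psiError, Set.indicator_of_notMem hu]
        simp
    rw [this, integral_sub hψ hexp, hexp']
    generalize (∫ u in Set.Ioi (0 : ℝ), ((psi (Real.exp u) * Real.exp (-u) : ℝ) : ℂ) *
      Complex.exp (-(z * u))) = J
    rw [add_sub_cancel_left]
    field_simp
    ring

lemma tendsto_integral_psiError {δ : ℝ} (hδ : 0 ≤ δ) :
    Tendsto (fun u ↦ ∫ w in (0 : ℝ)..δ, psiError (u - w)) atTop (𝓝 0) := by
  obtain ⟨G, hG⟩ := exists_hasLaplaceExtension_psiError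
  have h := (hG.movingIntegral hδ).tendsto_zero
    (by linarith [log_four_nonneg]) (hG.norm_integral_comp_sub_le δ)
  simp_rw [intervalIntegral.integral_ofReal] at h
  simpa [Function.comp_def] using (Complex.continuous_re.tendsto 0).comp h

lemma intervalIntegrable_psiError_comp_sub (u a b : ℝ) :
    IntervalIntegrable (fun w ↦ psiError (u - w)) volume a b := by
  obtain ⟨G, hG⟩ := exists_hasLaplaceExtension_psiError
  refine (intervalIntegrable_const (c := Real.log 4 + 5)).mono_fun
    (measurable_psiError.comp (by fun_prop)).aestronglyMeasurable (ae_of_all _ fun w ↦ ?_)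
  have := hG.bound (u - w)
  rw [Complex.norm_real] at this
  exact this.trans (le_abs_self _)

lemma integral_psiError_le {δ u : ℝ} (hδ : 0 ≤ δ) (hu : δ ≤ u) :
    ∫ w in (0 : ℝ)..δ, psiError (u - w) ≤
      δ * (Real.exp δ * (psi (Real.exp u) * Real.exp (-u)) - 1) := by
  rw [← smul_eq_mul, ← sub_zero δ, ← intervalIntegral.integral_const, sub_zero]
  refine intervalIntegral.integral_mono_on hδ (intervalIntegrable_psiError_comp_sub _ _ _)
    intervalIntegrable_const fun w hw ↦ ?_
  rw [psiError, Set.indicator_of_mem (Set.mem_Ici.2 (by linarith [hw.2]))]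
  rw [show -(u - w) = w + -u by ring, Real.exp_add, mul_left_comm]
  have h1 : psi (Real.exp (u - w)) ≤ psi (Real.exp u) :=
    psi_mono (Real.exp_le_exp.2 (by linarith [hw.1]))
  have h2 := psi_nonneg (Real.exp u)
  gcongr
  exact hw.2

lemma le_integral_psiError {δ u : ℝ} (hδ : 0 ≤ δ) (hu : 0 ≤ u) :
    δ * (Real.exp (-δ) * (psi (Real.exp u) * Real.exp (-u)) - 1) ≤
      ∫ w in (0 : ℝ)..δ, psiError (u + δ - w) := by
  rw [← smul_eq_mul, ← sub_zero δ, ← intervalIntegral.integral_const, sub_zero]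
  refine intervalIntegral.integral_mono_on hδ intervalIntegrable_const
    (intervalIntegrable_psiError_comp_sub _ _ _) fun w hw ↦ ?_
  rw [psiError, Set.indicator_of_mem (Set.mem_Ici.2 (by linarith [hw.2])), mul_left_comm,
    ← Real.exp_add]
  have h1 : psi (Real.exp u) ≤ psi (Real.exp (u + δ - w)) :=
    psi_mono (Real.exp_le_exp.2 (by linarith [hw.2]))
  have h2 := psi_nonneg (Real.exp u)
  gcongr
  linarith [hw.1]

lemma tendsto_psi_exp_mul_exp_neg :
    Tendsto (fun u ↦ psi (Real.exp u) * Real.exp (-u)) atTop (𝓝 1) := by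
  rw [tendsto_order]
  constructor
  · intro c hc
    have hcont : Tendsto (fun δ : ℝ ↦ Real.exp (-δ)) (𝓝[>] 0) (𝓝 1) := by
      have : Continuous fun δ : ℝ ↦ Real.exp (-δ) := by fun_prop
      simpa using (this.tendsto 0).mono_left nhdsWithin_le_nhds
    obtain ⟨δ, hcδ, hδ⟩ := ((hcont.eventually_const_lt hc).and self_mem_nhdsWithin).exists
    replace hδ : 0 < δ := hδ
    have hlim : Tendsto (fun u ↦ Real.exp (-δ) * (1 + (∫ w in (0 : ℝ)..δ, psiError (u - w)) / δ))
        atTop (𝓝 (Real.exp (-δ))) := by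
      simpa using (((tendsto_integral_psiError hδ.le).div_const δ).const_add 1).const_mul
        (Real.exp (-δ))
    filter_upwards [hlim.eventually_const_lt hcδ, eventually_ge_atTop δ] with u h1 h2
    refine h1.trans_le ?_
    rw [Real.exp_neg, inv_mul_le_iff₀ (Real.exp_pos δ), ← le_sub_iff_add_le', div_le_iff₀' hδ]
    exact integral_psiError_le hδ.le h2
  · intro c hc
    have hcont : Tendsto (fun δ : ℝ ↦ Real.exp δ) (𝓝[>] 0) (𝓝 1) := by
      simpa using (Real.continuous_exp.tendsto 0).mono_left nhdsWithin_le_nhds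
    obtain ⟨δ, hcδ, hδ⟩ := ((hcont.eventually_lt_const hc).and self_mem_nhdsWithin).exists
    replace hδ : 0 < δ := hδ
    have hlim : Tendsto (fun u ↦ Real.exp δ * (1 + (∫ w in (0 : ℝ)..δ, psiError (u + δ - w)) / δ))
        atTop (𝓝 (Real.exp δ)) := by
      simpa using ((((tendsto_integral_psiError hδ.le).comp
        (tendsto_atTop_add_const_right _ δ tendsto_id)).div_const δ).const_add 1).const_mul
        (Real.exp δ)
    filter_upwards [hlim.eventually_lt_const hcδ, eventually_ge_atTop 0] with u h1 h2
    refine lt_of_le_of_lt ?_ h1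
    rw [← inv_mul_le_iff₀ (Real.exp_pos δ), ← Real.exp_neg, ← sub_le_iff_le_add', le_div_iff₀' hδ]
    exact le_integral_psiError hδ.le h2

/-- The prime number theorem for `ψ`. -/
theorem tendsto_psi_div_self : Tendsto (fun x ↦ psi x / x) atTop (𝓝 1) := by
  refine (tendsto_psi_exp_mul_exp_neg.comp Real.tendsto_log_atTop).congr' ?_
  filter_upwards [eventually_gt_atTop 0] with x hx
  simp [Real.exp_neg, Real.exp_log hx, div_eq_mul_inv]

/-- The prime number theorem for `θ`. -/
theorem tendsto_theta_div_self : Tendsto (fun x ↦ theta x / x) atTop (𝓝 1) := by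
  have h : (psi - theta) =o[atTop] (fun x : ℝ ↦ x) := by
    refine isBigO_psi_sub_theta_sqrt.trans_isLittleO ?_
    refine (Asymptotics.isLittleO_iff_tendsto' ?_).2 ?_
    · filter_upwards [eventually_ne_atTop 0] with x hx h using absurd h hx
    · simp_rw [Real.sqrt_div_self', one_div]
      exact Real.tendsto_sqrt_atTop.inv_tendsto_atTop
  have := tendsto_psi_div_self.sub h.tendsto_div_nhds_zero
  rw [sub_zero] at this
  refine this.congr fun x ↦ ?_
  rw [Pi.sub_apply]
  ring

/-- The prime number theorem. -/
theorem tendsto_primeCounting_mul_log_div :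
    Tendsto (fun x : ℝ ↦ Nat.primeCounting ⌊x⌋₊ * Real.log x / x) atTop (𝓝 1) := by
  have h : (fun x : ℝ ↦ Nat.primeCounting ⌊x⌋₊ - theta x / Real.log x) =o[atTop]
      (fun x : ℝ ↦ x / Real.log x) := by
    refine primeCounting_sub_theta_div_log_isBigO.trans_isLittleO ?_
    refine Asymptotics.isLittleO_iff_tendsto' ?_ |>.2 ?_
    · filter_upwards [eventually_gt_atTop 1] with x hx h
      have := Real.log_pos hx
      have : 0 < x / Real.log x := by positivity
      exact absurd h this.ne'
    · refine Real.tendsto_log_atTop.inv_tendsto_atTop.congr' ?_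
      filter_upwards [eventually_gt_atTop 1] with x hx
      have := Real.log_pos hx
      simp only [Pi.inv_apply]
      field_simp
  have := tendsto_theta_div_self.add h.tendsto_div_nhds_zero
  rw [add_zero] at this
  refine this.congr' ?_
  filter_upwards [eventually_gt_atTop 1] with x hx
  have := Real.log_pos hx
  field_simp
  ring

end Chebyshev

open Chebyshev

lemma integral_indicator_Ici_rpow {σ a : ℝ} (hσ : σ ≠ 0) (ha : 0 < a) (ha1 : a ≤ 1) :
    ∫ s in (0 : ℝ)..1, (Set.Ici a).indicator (fun s ↦ σ * s ^ (-σ - 1)) s = a ^ (-σ) - 1 := by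
  have hset : Set.Ioc (0 : ℝ) 1 ∩ Set.Ici a = Set.Icc a 1 := by
    ext s
    simp only [Set.mem_inter_iff, Set.mem_Ioc, Set.mem_Ici, Set.mem_Icc]
    grind
  rw [intervalIntegral.integral_of_le zero_le_one, setIntegral_indicator measurableSet_Ici, hset,
    integral_Icc_eq_integral_Ioc, ← intervalIntegral.integral_of_le ha1,
    intervalIntegral.integral_const_mul, integral_rpow]
  · rw [Real.one_rpow, sub_add_cancel]
    field_simp
    ring
  · right
    refine ⟨fun h ↦ hσ (by linarith), fun h ↦ ?_⟩
    rw [Set.uIcc_of_le ha1] at h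
    exact absurd h.1 (not_le.2 ha)

lemma intervalIntegrable_indicator_Ici_rpow {σ a : ℝ} (ha : 0 < a) :
    IntervalIntegrable ((Set.Ici a).indicator fun s ↦ σ * s ^ (-σ - 1)) volume 0 1 := by
  have hset : Set.Ici a ∩ Set.Ioc (0 : ℝ) 1 = Set.Icc a 1 := by
    ext s
    simp only [Set.mem_inter_iff, Set.mem_Ioc, Set.mem_Ici, Set.mem_Icc]
    grind
  rw [intervalIntegrable_iff_integrableOn_Ioc_of_le zero_le_one, IntegrableOn,
    integrable_indicator_iff measurableSet_Ici, IntegrableOn, Measure.restrict_restrict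
      measurableSet_Ici, hset]
  refine ContinuousOn.integrableOn_Icc fun s hs ↦ ?_
  exact ((Real.continuousAt_rpow_const s _ (Or.inl (ha.trans_le hs.1).ne')).const_mul
    σ).continuousWithinAt

lemma primeCounting_eq_sum_indicator {X s σ : ℝ} (hX : 0 < X) (hs : s ∈ Set.Ioc (0 : ℝ) 1) :
    (Nat.primeCounting ⌊X * s⌋₊ : ℝ) * (σ * s ^ (-σ - 1)) =
      ∑ p ∈ (Finset.Iic ⌊X⌋₊).filter Nat.Prime,
        (Set.Ici ((p : ℝ) / X)).indicator (fun s ↦ σ * s ^ (-σ - 1)) s := by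
  have h (p : ℕ) : s ∈ Set.Ici ((p : ℝ) / X) ↔ p ≤ ⌊X * s⌋₊ := by
    rw [Set.mem_Ici, div_le_iff₀' hX, Nat.le_floor_iff (mul_pos hX hs.1).le]
  have hle : ⌊X * s⌋₊ ≤ ⌊X⌋₊ := Nat.floor_le_floor (mul_le_of_le_one_right hX.le hs.2)
  classical
  simp_rw [Set.indicator_apply, h]
  rw [← Finset.sum_filter, Finset.sum_const, nsmul_eq_mul, ← Nat.primesLE_card_eq_primeCounting]
  congr 3
  ext p
  simp only [Nat.mem_primesLE, Finset.mem_filter, Finset.mem_Iic]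
  grind

lemma sum_prime_eq_integral {X σ : ℝ} (hX : 0 < X) (hσ : 0 < σ) :
    ∑ p ∈ (Finset.Iic ⌊X⌋₊).filter Nat.Prime, (1 - ((p : ℝ) / X) ^ σ) * (p : ℝ) ^ (-σ) =
      X ^ (-σ) *
        ∫ s in (0 : ℝ)..1, (Nat.primeCounting ⌊X * s⌋₊ : ℝ) * (σ * s ^ (-σ - 1)) := by
  have hp {p : ℕ} (h : p ∈ (Finset.Iic ⌊X⌋₊).filter Nat.Prime) :
      (0 : ℝ) < p ∧ 0 < (p : ℝ) / X ∧ (p : ℝ) / X ≤ 1 := by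
    rw [Finset.mem_filter, Finset.mem_Iic, Nat.le_floor_iff hX.le] at h
    have h0 : (0 : ℝ) < p := by exact_mod_cast h.2.pos
    exact ⟨h0, div_pos h0 hX, (div_le_one hX).2 h.1⟩
  rw [intervalIntegral.integral_of_le zero_le_one, setIntegral_congr_fun measurableSet_Ioc
    fun s hs ↦ primeCounting_eq_sum_indicator hX hs, ← intervalIntegral.integral_of_le zero_le_one,
    intervalIntegral.integral_finsetSum fun p h ↦
      intervalIntegrable_indicator_Ici_rpow (hp h).2.1, Finset.mul_sum]
  refine Finset.sum_congr rfl fun p h ↦ ?_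
  obtain ⟨h0, h1, h2⟩ := hp h
  rw [integral_indicator_Ici_rpow hσ.ne' h1 h2, Real.div_rpow h0.le hX.le,
    Real.div_rpow h0.le hX.le, Real.rpow_neg h0.le, Real.rpow_neg hX.le]
  have := Real.rpow_pos_of_pos h0 σ
  have := Real.rpow_pos_of_pos hX σ
  field_simp

lemma tendsto_primeCounting_mul_log_div_of_pos {s : ℝ} (hs : 0 < s) :
    Tendsto (fun X : ℝ ↦ Nat.primeCounting ⌊X * s⌋₊ * Real.log X / X) atTop (𝓝 s) := by
  have hXs : Tendsto (fun X : ℝ ↦ X * s) atTop atTop := tendsto_id.atTop_mul_const hs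
  have hlog : Tendsto (fun X : ℝ ↦ 1 - Real.log s / Real.log (X * s)) atTop (𝓝 1) := by
    simpa using ((Real.tendsto_log_atTop.comp hXs).const_div_atTop (Real.log s)).const_sub 1
  have := ((tendsto_primeCounting_mul_log_div.comp hXs).mul hlog).mul_const s
  rw [one_mul, one_mul] at this
  refine this.congr' ?_
  filter_upwards [hXs.eventually_gt_atTop 1, eventually_gt_atTop 0] with X h1 h2
  have h3 := Real.log_pos h1
  have h4 : Real.log X = Real.log (X * s) - Real.log s := by
    rw [Real.log_mul h2.ne' hs.ne']
    ring
  rw [Function.comp_apply, h4]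
  field_simp

lemma primeCounting_le_self (n : ℕ) : Nat.primeCounting n ≤ n := by
  rw [← Nat.primesLE_card_eq_primeCounting, Nat.primesLE_eq_filter_Icc_one]
  simpa using Finset.card_filter_le (Finset.Icc 1 n) Nat.Prime

lemma eventually_primeCounting_mul_log_div_le {η : ℝ} (hη : 0 < η) :
    ∀ᶠ X : ℝ in atTop, ∀ s ∈ Set.Ioc (0 : ℝ) 1,
      Nat.primeCounting ⌊X * s⌋₊ * Real.log X / X ≤ (4 + 2 / η) * (s * s ^ (-η)) := by
  obtain ⟨N, hN⟩ := eventually_atTop.1 (tendsto_primeCounting_mul_log_div.eventually_le_const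
    one_lt_two)
  filter_upwards [eventually_gt_atTop 1, eventually_ge_atTop (N ^ 2)] with X hX hXN s hs
  have hX0 : 0 < X := zero_lt_one.trans hX
  have hXs : 0 < X * s := mul_pos hX0 hs.1
  have hlogX := Real.log_pos hX
  have hη1 : 1 ≤ s ^ (-η) := Real.one_le_rpow_of_pos_of_le_one_of_nonpos hs.1 hs.2 (by linarith)
  have hlogs : -Real.log s ≤ s ^ (-η) / η := by
    have := Real.log_le_rpow_div (inv_nonneg.2 hs.1.le) hη
    rwa [Real.log_inv, Real.inv_rpow hs.1.le, ← Real.rpow_neg hs.1.le] at this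
  have hs0 := hs.1
  by_cases h : Real.log X ≤ 2 * -Real.log s
  · have hπ : (Nat.primeCounting ⌊X * s⌋₊ : ℝ) ≤ X * s :=
      (Nat.cast_le.2 (primeCounting_le_self _)).trans (Nat.floor_le hXs.le)
    calc _ ≤ X * s * (2 * (s ^ (-η) / η)) / X := by
          gcongr
          linarith
      _ = (2 / η) * (s * s ^ (-η)) := by field_simp
      _ ≤ _ := by gcongr; linarith
  · have hlog : Real.log X ≤ 2 * Real.log (X * s) := by
      rw [Real.log_mul hX0.ne' hs0.ne']
      linarith
    have hNX : N ≤ X * s := by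
      refine (abs_le_of_sq_le_sq' (hXN.trans ?_) hXs.le).2
      rw [← Real.log_le_log_iff hX0 (by positivity), Real.log_pow]
      exact_mod_cast hlog
    have hπ := hN _ hNX
    rw [div_le_iff₀ hXs] at hπ
    calc _ ≤ Nat.primeCounting ⌊X * s⌋₊ * (2 * Real.log (X * s)) / X := by gcongr
      _ = 2 * (Nat.primeCounting ⌊X * s⌋₊ * Real.log (X * s)) / X := by ring
      _ ≤ 2 * (2 * (X * s)) / X := by gcongr
      _ = 4 * (s * 1) := by field_simp; ring
      _ ≤ (4 + 2 / η) * (s * s ^ (-η)) := by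
          gcongr
          exact le_add_of_nonneg_right (by positivity)

/-- For fixed `σ ∈ (1/2, 1)`, as `X → ∞`,
`∑_{p ≤ X prime} (1 - (p/X)^σ) p^{-σ} = (σ/(1-σ) + o(1)) X^{1-σ} / log X`. -/
theorem resonator_prime_sum_asymptotic (σ : ℝ) (hσ : σ ∈ Set.Ioo (1/2 : ℝ) 1) :
    Filter.Tendsto
      (fun X : ℝ =>
        (∑ p ∈ (Finset.Iic ⌊X⌋₊).filter Nat.Prime,
            (1 - ((p : ℝ) / X) ^ σ) * (p : ℝ) ^ (-σ)) /
          (X ^ (1 - σ) / Real.log X))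
      Filter.atTop (nhds (σ / (1 - σ))) := by
  have hσ0 : 0 < σ := by linarith [hσ.1]
  have hσ1 : 0 < 1 - σ := by linarith [hσ.2]
  set η := (1 - σ) / 2 with hη
  have hη0 : 0 < η := by positivity
  have hlim : ∫ s in (0 : ℝ)..1, s * (σ * s ^ (-σ - 1)) = σ / (1 - σ) := by
    have : ∫ s in (0 : ℝ)..1, s * (σ * s ^ (-σ - 1)) = ∫ s in (0 : ℝ)..1, σ * s ^ (-σ) := by
      refine intervalIntegral.integral_congr_ae (ae_of_all _ fun s hs ↦ ?_)
      rw [Set.uIoc_of_le zero_le_one] at hs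
      rw [Real.rpow_sub_one hs.1.ne']
      field_simp [hs.1.ne']
    rw [this, intervalIntegral.integral_const_mul, integral_rpow (Or.inl (by linarith)),
      Real.one_rpow, Real.zero_rpow (by linarith)]
    rw [sub_zero, neg_add_eq_sub, mul_one_div]
  rw [← hlim]
  have hconv : Tendsto (fun X : ℝ ↦ ∫ s in (0 : ℝ)..1,
      Nat.primeCounting ⌊X * s⌋₊ * Real.log X / X * (σ * s ^ (-σ - 1))) atTop
      (𝓝 (∫ s in (0 : ℝ)..1, s * (σ * s ^ (-σ - 1)))) := by
    refine intervalIntegral.tendsto_integral_filter_of_dominated_convergence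
      (fun s ↦ σ * (4 + 2 / η) * s ^ (-σ - η)) ?_ ?_ ?_ ?_
    · refine Eventually.of_forall fun X ↦ Measurable.aestronglyMeasurable ?_
      have : Measurable fun s : ℝ ↦ (Nat.primeCounting ⌊X * s⌋₊ : ℝ) :=
        (measurable_from_nat (f := fun n ↦ (Nat.primeCounting n : ℝ))).comp
          (Nat.measurable_floor.comp (by fun_prop))
      fun_prop
    · filter_upwards [eventually_primeCounting_mul_log_div_le hη0, eventually_gt_atTop 1]
        with X hX hX1
      refine ae_of_all _ fun s hs ↦ ?_
      rw [Set.uIoc_of_le zero_le_one] at hs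
      have hs0 := hs.1
      have := Real.log_pos hX1
      rw [Real.norm_of_nonneg (by positivity)]
      calc _ ≤ (4 + 2 / η) * (s * s ^ (-η)) * (σ * s ^ (-σ - 1)) := by
            gcongr
            exact hX s hs
        _ = σ * (4 + 2 / η) * (s * s ^ (-η) * s ^ (-σ - 1)) := by ring
        _ = _ := by
            rw [← Real.rpow_one_add' hs0.le (by linarith), ← Real.rpow_add hs0]
            congr 2
            ring
    · exact (intervalIntegral.intervalIntegrable_rpow' (by linarith)).const_mul _
    · refine ae_of_all _ fun s hs ↦ ?_
      rw [Set.uIoc_of_le zero_le_one] at hs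
      exact (tendsto_primeCounting_mul_log_div_of_pos hs.1).mul_const _
  refine hconv.congr' ?_
  filter_upwards [eventually_gt_atTop 1] with X hX
  have hX0 : 0 < X := zero_lt_one.trans hX
  have hlogX := Real.log_pos hX
  rw [sum_prime_eq_integral hX0 hσ0, sub_eq_add_neg (1 : ℝ) σ, Real.rpow_add hX0, Real.rpow_one]
  have hpow := Real.rpow_pos_of_pos hX0 (-σ)
  calc _ = ∫ s in (0 : ℝ)..1, Real.log X / X *
        (Nat.primeCounting ⌊X * s⌋₊ * (σ * s ^ (-σ - 1))) := by
        congr 1 with s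
        ring
    _ = _ := by
        rw [intervalIntegral.integral_const_mul]
        field_simp
        congr 1 with s
        ring
end

section
/- Let σ ∈ (1/2, 1) be fixed and let λ(σ) = ∫₀¹ t^{σ}/(2 − t^{σ}) dt. Let r(p) = 1 − (p/X)^{σ} for primes p ≤ X. Then as X → ∞, ∑_{p ≤ X, p prime} ( −log(1 − r(p)²) ) = ( σ(1 − λ(σ)) + o(1) ) · X / log X; that is, the ratio of this sum to X/log X tends to σ(1 − λ(σ)) as X → ∞. -/
section

open Filter Topology MeasureTheory Set

/-- The negated logarithmic derivative of `ζ`, minus `1/(s-1)`, in terms of the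
entire function `(s-1) ζ(s)`. -/
lemma neg_logDeriv_riemannZeta_sub {s : ℂ} (hs : s ≠ 1) (hζ : riemannZeta s ≠ 0) :
    -deriv riemannZeta s / riemannZeta s - 1 / (s - 1) =
      -deriv riemannZeta₁ s / riemannZeta₁ s := by
  have hs' : s - 1 ≠ 0 := sub_ne_zero.mpr hs
  have hE : riemannZeta =ᶠ[𝓝 s] fun z ↦ (z - 1)⁻¹ * riemannZeta₁ z := by
    filter_upwards [isOpen_ne.mem_nhds hs] with z hz using riemannZeta_eq_inv_sub_mul hz
  have h1 : riemannZeta₁ s ≠ 0 := by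
    intro h; apply hζ; rw [riemannZeta_eq_inv_sub_mul hs, h, mul_zero]
  have hd : HasDerivAt (fun z ↦ (z - 1)⁻¹ * riemannZeta₁ z)
      (-1 / (s - 1) ^ 2 * riemannZeta₁ s + (s - 1)⁻¹ * deriv riemannZeta₁ s) s :=
    (((hasDerivAt_id s).sub_const 1).fun_inv hs').mul
      (differentiable_riemannZeta₁ s).hasDerivAt
  rw [hE.deriv_eq, hd.deriv, riemannZeta_eq_inv_sub_mul hs]
  field_simp
  ring

lemma riemannZeta₁_ne_zero_of_one_le_re {s : ℂ} (hs : 1 ≤ s.re) : riemannZeta₁ s ≠ 0 := by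
  rcases eq_or_ne s 1 with rfl | h
  · simp
  · intro h0
    exact riemannZeta_ne_zero_of_one_le_re hs (by rw [riemannZeta_eq_inv_sub_mul h, h0, mul_zero])

/-- The Laplace transform of `u ↦ ψ(eᵘ)e⁻ᵘ - 1`. -/
noncomputable def psiLaplace (z : ℂ) : ℂ :=
  (-deriv riemannZeta₁ (1 + z) / riemannZeta₁ (1 + z) - 1) / (1 + z)

lemma continuousOn_psiLaplace : ContinuousOn psiLaplace {z | 0 ≤ z.re} := by
  have hd : Continuous (deriv riemannZeta₁) :=
    (differentiable_riemannZeta₁.contDiff (n := 1)).continuous_deriv le_rfl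
  have hc : Continuous riemannZeta₁ := differentiable_riemannZeta₁.continuous
  unfold psiLaplace
  refine ContinuousOn.div (ContinuousOn.sub (ContinuousOn.div ?_ ?_ ?_) ?_) ?_ ?_
  any_goals fun_prop
  · intro z hz
    exact riemannZeta₁_ne_zero_of_one_le_re (by simpa using hz)
  · intro z hz h
    have := congrArg Complex.re h
    simp at this
    have hz' : 0 ≤ z.re := hz
    linarith

/-- The normalised Chebyshev function `u ↦ ψ(eᵘ)e⁻ᵘ`. -/
noncomputable def psiExp (u : ℝ) : ℝ := Chebyshev.psi (Real.exp u) * Real.exp (-u)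

lemma psiExp_nonneg (u : ℝ) : 0 ≤ psiExp u :=
  mul_nonneg (Chebyshev.psi_nonneg _) (Real.exp_pos _).le

lemma psiExp_le (u : ℝ) : psiExp u ≤ Real.log 4 + 4 := by
  unfold psiExp
  rw [Real.exp_neg, ← div_eq_mul_inv, div_le_iff₀ (Real.exp_pos _)]
  exact Chebyshev.psi_le_const_mul_self (Real.exp_pos _).le

lemma measurable_psiExp : Measurable psiExp :=
  (Chebyshev.psi_mono.measurable.comp Real.measurable_exp).mul
    (Real.measurable_exp.comp measurable_neg)

lemma psiExp_mul_exp_le {u v : ℝ} (h : u ≤ v) : psiExp u * Real.exp (u - v) ≤ psiExp v := by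
  unfold psiExp
  rw [mul_assoc, ← Real.exp_add, show -u + (u - v) = -v by ring]
  gcongr

lemma integral_psiExp_mul_exp {z : ℂ} (hz : 0 < z.re) :
    ∫ u in Ioi (0 : ℝ), (psiExp u : ℂ) * Complex.exp (-z * u) =
      (-deriv riemannZeta (1 + z) / riemannZeta (1 + z)) / (1 + z) := by
  have hre : 1 < (1 + z).re := by simpa using hz
  have hne : 1 + z ≠ 0 := fun h ↦ by rw [h] at hre; norm_num at hre
  have hO : (fun n : ℕ ↦ ∑ k ∈ Finset.Icc 1 n, ArithmeticFunction.vonMangoldt k) =O[atTop]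
      fun n ↦ (n : ℝ) ^ (1 : ℝ) := by
    refine Asymptotics.IsBigO.of_bound (Real.log 4 + 4) (Eventually.of_forall fun n ↦ ?_)
    have h := Chebyshev.psi_le_const_mul_self (x := n) n.cast_nonneg
    have h0 := Chebyshev.psi_nonneg n
    rw [Chebyshev.psi, Nat.floor_natCast] at h h0
    rw [show Finset.Icc 1 n = Finset.Ioc 0 n from rfl, Real.norm_of_nonneg h0, Real.rpow_one,
      Real.norm_of_nonneg n.cast_nonneg]
    exact h
  have key := LSeries_eq_mul_integral_of_nonneg _ zero_le_one hre hO
    fun _ ↦ ArithmeticFunction.vonMangoldt_nonneg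
  rw [ArithmeticFunction.LSeries_vonMangoldt_eq_deriv_riemannZeta_div hre] at key
  rw [key, mul_div_cancel_left₀ _ hne, ← Real.exp_zero, ← integral_comp_exp_Ioi]
  refine setIntegral_congr_fun measurableSet_Ioi fun u _ ↦ ?_
  have : (∑ k ∈ Finset.Icc 1 ⌊Real.exp u⌋₊, (ArithmeticFunction.vonMangoldt k : ℂ)) =
      (Chebyshev.psi (Real.exp u) : ℂ) := by
    rw [Chebyshev.psi]; push_cast; rfl
  simp only [this, psiExp, Complex.real_smul]
  rw [Complex.cpow_def_of_ne_zero (by simp), ← Complex.ofReal_log (Real.exp_pos _).le,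
    Real.log_exp]
  push_cast
  rw [mul_assoc, ← Complex.exp_add, mul_left_comm, ← Complex.exp_add]
  congr 2
  ring

lemma integral_psiExp_sub_one_mul_exp {z : ℂ} (hz : 0 < z.re) :
    ∫ u in Ioi (0 : ℝ), ((psiExp u - 1 : ℝ) : ℂ) * Complex.exp (-z * u) = psiLaplace z := by
  have hexp : IntegrableOn (fun u : ℝ ↦ Complex.exp (-z * u)) (Ioi 0) :=
    integrableOn_exp_mul_complex_Ioi (by simpa using hz) 0
  have hmul : IntegrableOn (fun u : ℝ ↦ (psiExp u : ℂ) * Complex.exp (-z * u)) (Ioi 0) := by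
    refine Integrable.bdd_mul (c := Real.log 4 + 4) hexp ?_ ?_
    · exact (Complex.measurable_ofReal.comp measurable_psiExp).aestronglyMeasurable
    · refine Eventually.of_forall fun u ↦ ?_
      rw [Complex.norm_real, Real.norm_of_nonneg (psiExp_nonneg u)]
      exact psiExp_le u
  have hre : 1 ≤ (1 + z).re := by simpa using hz.le
  have hz0 : z ≠ 0 := fun h ↦ by simp [h] at hz
  have hne : 1 + z ≠ 0 := fun h ↦ by rw [h] at hre; norm_num at hre
  simp only [Complex.ofReal_sub, sub_mul, Complex.ofReal_one, one_mul]
  rw [integral_sub hmul hexp, integral_psiExp_mul_exp hz,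
    integral_exp_mul_complex_Ioi (by simpa using hz), psiLaplace,
    ← neg_logDeriv_riemannZeta_sub (by simpa using hz0) (riemannZeta_ne_zero_of_one_le_re hre)]
  simp only [Complex.ofReal_zero, mul_zero, Complex.exp_zero, add_sub_cancel_left]
  have := riemannZeta_ne_zero_of_one_le_re hre
  field_simp
  ring

/-- The Fejér kernel, i.e. the Fourier transform of the tent function on `[-1, 1]`. -/
noncomputable def fejerKernel (x : ℝ) : ℝ := Real.sinc (x / 2) ^ 2

lemma continuous_fejerKernel : Continuous fejerKernel := by
  unfold fejerKernel
  exact (Real.continuous_sinc.comp (continuous_id.div_const 2)).pow 2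

lemma fejerKernel_nonneg (x : ℝ) : 0 ≤ fejerKernel x := sq_nonneg _

lemma fejerKernel_mul_sq (x : ℝ) : fejerKernel x * x ^ 2 = 2 * (1 - Real.cos x) := by
  rcases eq_or_ne x 0 with rfl | hx
  · simp
  have h := Real.cos_sq_add_sin_sq (x / 2)
  have h2 := Real.cos_two_mul (x / 2)
  rw [mul_div_cancel₀ x two_ne_zero] at h2
  rw [fejerKernel, Real.sinc_of_ne_zero (by positivity)]
  field_simp
  linarith

lemma fejerKernel_le (x : ℝ) : fejerKernel x ≤ 5 * (1 + x ^ 2)⁻¹ := by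
  rw [← div_eq_mul_inv, le_div_iff₀ (by positivity), mul_add, mul_one, fejerKernel_mul_sq]
  have h1 : fejerKernel x ≤ 1 := by
    rw [fejerKernel, ← sq_abs]
    exact pow_le_one₀ (abs_nonneg _) (Real.abs_sinc_le_one _)
  linarith [Real.neg_one_le_cos x]

lemma integrable_fejerKernel : Integrable fejerKernel := by
  refine (integrable_inv_one_add_sq.const_mul 5).mono'
    continuous_fejerKernel.aestronglyMeasurable (Eventually.of_forall fun x ↦ ?_)
  rw [Real.norm_of_nonneg (fejerKernel_nonneg x)]
  exact fejerKernel_le x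

lemma integral_fejerKernel_pos : 0 < ∫ x, fejerKernel x := by
  rw [integral_pos_iff_support_of_nonneg fejerKernel_nonneg integrable_fejerKernel]
  refine (continuous_fejerKernel.isOpen_support).measure_pos volume ⟨0, ?_⟩
  simp [fejerKernel]

lemma intervalIntegral_tent_mul_exp (x : ℝ) :
    ∫ t in (-1 : ℝ)..1, ((1 - |t| : ℝ) : ℂ) * Complex.exp (t * x * Complex.I) =
      fejerKernel x := by
  have hc : Continuous fun t : ℝ ↦ ((1 - |t| : ℝ) : ℂ) * Complex.exp (t * x * Complex.I) := by
    fun_prop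
  have key : ∀ y : ℝ, y ≠ 0 →
      ∫ t in (0 : ℝ)..1, ((1 - t : ℝ) : ℂ) * Complex.exp (t * y * Complex.I) =
        1 / y ^ 2 + Complex.I / y - Complex.exp (y * Complex.I) / y ^ 2 := by
    intro y hy
    have hy' : (y : ℂ) ≠ 0 := Complex.ofReal_ne_zero.mpr hy
    have hderiv : ∀ t : ℝ, HasDerivAt (fun t : ℝ ↦
        (-Complex.I * (1 - t) / y - 1 / y ^ 2) * Complex.exp (t * y * Complex.I))
        (((1 - t : ℝ) : ℂ) * Complex.exp (t * y * Complex.I)) t := by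
      intro t
      have h1 : HasDerivAt (fun t : ℂ ↦
          (-Complex.I * (1 - t) / y - 1 / y ^ 2) * Complex.exp (t * y * Complex.I))
          ((-Complex.I * (-1) / y) * Complex.exp (t * y * Complex.I) +
            (-Complex.I * (1 - t) / y - 1 / y ^ 2) *
              (Complex.exp (t * y * Complex.I) * (1 * y * Complex.I))) t := by
        refine HasDerivAt.mul ?_ ?_
        · exact (((((hasDerivAt_id (t : ℂ)).const_sub 1)).const_mul _).div_const _).sub_const _
        · exact (((hasDerivAt_id (t : ℂ)).mul_const _).mul_const _).cexp
      convert h1.comp_ofReal using 1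
      push_cast
      field_simp
      linear_combination ((y : ℂ) * (1 - t)) * Complex.I_sq
    rw [intervalIntegral.integral_eq_sub_of_hasDerivAt (fun t _ ↦ hderiv t)
      (Continuous.intervalIntegrable (by fun_prop) _ _)]
    simp
    ring
  rw [← intervalIntegral.integral_add_adjacent_intervals (b := 0) (hc.intervalIntegrable _ _)
    (hc.intervalIntegrable _ _)]
  have hneg : ∫ t in (-1 : ℝ)..0, ((1 - |t| : ℝ) : ℂ) * Complex.exp (t * x * Complex.I) =
      ∫ t in (0 : ℝ)..1, ((1 - t : ℝ) : ℂ) * Complex.exp (t * (-x : ℝ) * Complex.I) := by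
    rw [← neg_zero, ← intervalIntegral.integral_comp_neg, neg_zero]
    refine intervalIntegral.integral_congr fun t ht ↦ ?_
    rw [uIcc_of_le zero_le_one] at ht
    simp [abs_of_nonneg ht.1]
  have hpos : ∫ t in (0 : ℝ)..1, ((1 - |t| : ℝ) : ℂ) * Complex.exp (t * x * Complex.I) =
      ∫ t in (0 : ℝ)..1, ((1 - t : ℝ) : ℂ) * Complex.exp (t * x * Complex.I) := by
    refine intervalIntegral.integral_congr fun t ht ↦ ?_
    rw [uIcc_of_le zero_le_one] at ht
    simp [abs_of_nonneg ht.1]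
  rw [hneg, hpos]
  rcases eq_or_ne x 0 with rfl | hx
  · have : ∫ t in (0 : ℝ)..1, (1 - (t : ℂ)) = ((1 / 2 : ℝ) : ℂ) := by
      rw [← show ∫ t in (0 : ℝ)..1, (1 - t) = 1 / 2 by
        rw [intervalIntegral.integral_sub (by simp) (by simp), integral_id]; norm_num,
        ← intervalIntegral.integral_ofReal]
      simp
    simp [fejerKernel, this]
    norm_num
  · rw [key x hx, key (-x) (neg_ne_zero.mpr hx)]
    have hx' : (x : ℂ) ≠ 0 := Complex.ofReal_ne_zero.mpr hx
    have hK : (fejerKernel x : ℂ) = 2 * (1 - Complex.cos x) / x ^ 2 := by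
      rw [eq_div_iff (by positivity)]
      exact_mod_cast congrArg (fun r : ℝ ↦ (r : ℂ)) (fejerKernel_mul_sq x)
    rw [hK, Complex.cos]
    push_cast
    field_simp
    ring_nf


section Tauberian

variable {E : ℝ → ℝ} {G : ℂ → ℂ} {C : ℝ}

lemma integrable_fejerKernel_comp {r : ℝ} (hr : r ≠ 0) (y : ℝ) :
    Integrable fun u ↦ fejerKernel (r * (y - u)) := by
  have h := (integrable_fejerKernel.comp_mul_left' hr).comp_sub_left y
  exact h

lemma intervalIntegral_tent_mul_laplace (hE : Measurable E) (hC : ∀ u, 0 < u → |E u| ≤ C)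
    (hG : ∀ z : ℂ, 0 < z.re →
      ∫ u in Ioi (0 : ℝ), (E u : ℂ) * Complex.exp (-z * u) = G z)
    {r δ : ℝ} (hδ : 0 < δ) (y : ℝ) :
    ∫ t in (-1 : ℝ)..1, ((1 - |t| : ℝ) : ℂ) * Complex.exp (t * (r * y : ℝ) * Complex.I) *
        G (δ + (r * t : ℝ) * Complex.I) =
      ((∫ u in Ioi (0 : ℝ), E u * Real.exp (-δ * u) * fejerKernel (r * (y - u)) : ℝ) : ℂ) := by
  have h1 : ∀ t : ℝ, ((1 - |t| : ℝ) : ℂ) * Complex.exp (t * (r * y : ℝ) * Complex.I) *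
        G (δ + (r * t : ℝ) * Complex.I) =
      ∫ u in Ioi (0 : ℝ), ((1 - |t| : ℝ) : ℂ) *
        Complex.exp (t * (r * (y - u) : ℝ) * Complex.I) * (E u * Real.exp (-δ * u) : ℝ) := by
    intro t
    rw [← hG _ (by simpa using hδ), ← integral_const_mul]
    refine setIntegral_congr_fun measurableSet_Ioi fun u _ ↦ ?_
    have : Complex.exp (t * (r * y : ℝ) * Complex.I) *
        Complex.exp (-(δ + (r * t : ℝ) * Complex.I) * u) =
        Complex.exp (t * (r * (y - u) : ℝ) * Complex.I) * (Real.exp (-δ * u) : ℝ) := by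
      rw [← Complex.exp_add, Complex.ofReal_exp, ← Complex.exp_add]
      congr 1
      push_cast
      ring
    rw [Complex.ofReal_mul (E u)]
    linear_combination ((1 - |t| : ℝ) : ℂ) * E u * this
  simp_rw [h1]
  rw [intervalIntegral_integral_swap, ← integral_complex_ofReal]
  · refine setIntegral_congr_fun measurableSet_Ioi fun u _ ↦ ?_
    rw [intervalIntegral.integral_mul_const, intervalIntegral_tent_mul_exp]
    push_cast
    ring
  · have hb : Integrable (fun p : ℝ × ℝ ↦ (1 : ℝ) * (C * Real.exp (-δ * p.2)))
        ((volume.restrict (uIoc (-1) 1)).prod (volume.restrict (Ioi 0))) :=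
      Integrable.mul_prod (f := fun _ : ℝ ↦ (1 : ℝ)) (g := fun u : ℝ ↦ C * Real.exp (-δ * u))
        (by simp) ((integrableOn_exp_mul_Ioi (neg_lt_zero.mpr hδ) 0).const_mul C)
    refine hb.mono' ?_ ?_
    · refine Measurable.aestronglyMeasurable ?_
      unfold Function.uncurry
      fun_prop
    · rw [Measure.prod_restrict, ae_restrict_iff' (measurableSet_uIoc.prod measurableSet_Ioi)]
      refine Eventually.of_forall fun p hp ↦ ?_
      obtain ⟨ht, hu⟩ := hp
      rw [uIoc_of_le (by norm_num)] at ht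
      have ht' : |p.1| ≤ 1 := abs_le.mpr ⟨ht.1.le, ht.2⟩
      simp only [Function.uncurry, norm_mul, Complex.norm_real, Complex.norm_exp_ofReal_mul_I,
        Real.norm_eq_abs, ← Complex.ofReal_mul, mul_one]
      rw [abs_of_nonneg (by linarith : 0 ≤ 1 - |p.1|), Real.abs_exp]
      gcongr
      · linarith [abs_nonneg p.1]
      · exact hC _ hu

/-- The Fourier-analytic core of the Wiener–Ikehara theorem: averages of `E` against Fejér kernels
vanish at infinity if the Laplace transform of `E` is continuous up to the imaginary axis. -/
lemma tendsto_integral_mul_fejerKernel (hE : Measurable E) (hC : ∀ u, 0 < u → |E u| ≤ C)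
    (hG : ∀ z : ℂ, 0 < z.re →
      ∫ u in Ioi (0 : ℝ), (E u : ℂ) * Complex.exp (-z * u) = G z)
    (hGc : ContinuousOn G {z | 0 ≤ z.re}) {r : ℝ} (hr : 0 < r) :
    Tendsto (fun y ↦ ∫ u in Ioi (0 : ℝ), E u * fejerKernel (r * (y - u))) atTop (𝓝 0) := by
  have hGc' : Continuous fun p : ℝ × ℝ ↦ G ((max p.1 0 : ℝ) + (r * p.2 : ℝ) * Complex.I) :=
    hGc.comp_continuous (by fun_prop) fun p ↦ by simp
  have hb : ∀ y : ℝ,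
      ((∫ u in Ioi (0 : ℝ), E u * fejerKernel (r * (y - u)) : ℝ) : ℂ) =
      ∫ t in (-1 : ℝ)..1, ((1 - |t| : ℝ) : ℂ) * Complex.exp (t * (r * y : ℝ) * Complex.I) *
        G ((r * t : ℝ) * Complex.I) := by
    intro y
    have hl : Tendsto (fun δ : ℝ ↦
        ((∫ u in Ioi (0 : ℝ), E u * Real.exp (-δ * u) * fejerKernel (r * (y - u)) : ℝ) : ℂ))
        (𝓝[>] 0) (𝓝 ((∫ u in Ioi (0 : ℝ), E u * fejerKernel (r * (y - u)) : ℝ) : ℂ)) := by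
      refine (Complex.continuous_ofReal.tendsto _).comp ?_
      refine tendsto_integral_filter_of_dominated_convergence
        (fun u ↦ C * fejerKernel (r * (y - u))) ?_ ?_ ?_ ?_
      · refine Eventually.of_forall fun δ ↦ Measurable.aestronglyMeasurable ?_
        have := continuous_fejerKernel.measurable
        fun_prop
      · filter_upwards [self_mem_nhdsWithin] with δ hδ
        rw [ae_restrict_iff' measurableSet_Ioi]
        refine Eventually.of_forall fun u hu ↦ ?_
        rw [norm_mul, norm_mul, Real.norm_of_nonneg (fejerKernel_nonneg _),
          Real.norm_of_nonneg (Real.exp_pos _).le]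
        refine mul_le_mul_of_nonneg_right ?_ (fejerKernel_nonneg _)
        have h0 : 0 ≤ δ * u := mul_nonneg (le_of_lt hδ) (le_of_lt hu)
        calc ‖E u‖ * Real.exp (-δ * u) ≤ C * 1 := by
              gcongr
              · exact (abs_nonneg _).trans (hC u hu)
              · exact hC u hu
              · rw [Real.exp_le_one_iff]; linarith
          _ = C := mul_one C
      · exact ((integrable_fejerKernel_comp hr.ne' y).const_mul C).integrableOn
      · refine Eventually.of_forall fun u ↦ ?_
        have : Continuous fun δ : ℝ ↦ E u * Real.exp (-δ * u) * fejerKernel (r * (y - u)) := by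
          fun_prop
        simpa using (this.tendsto 0).mono_left nhdsWithin_le_nhds
    have hr : Tendsto (fun δ : ℝ ↦ ∫ t in (-1 : ℝ)..1, ((1 - |t| : ℝ) : ℂ) *
        Complex.exp (t * (r * y : ℝ) * Complex.I) *
        G ((max δ 0 : ℝ) + (r * t : ℝ) * Complex.I)) (𝓝[>] 0)
        (𝓝 (∫ t in (-1 : ℝ)..1, ((1 - |t| : ℝ) : ℂ) *
          Complex.exp (t * (r * y : ℝ) * Complex.I) * G ((r * t : ℝ) * Complex.I))) := by
      have := intervalIntegral.continuous_parametric_intervalIntegral_of_continuous' (μ := volume)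
        (f := fun δ t : ℝ ↦ ((1 - |t| : ℝ) : ℂ) * Complex.exp (t * (r * y : ℝ) * Complex.I) *
        G ((max δ 0 : ℝ) + (r * t : ℝ) * Complex.I))
        (by
          refine Continuous.mul (f := fun p : ℝ × ℝ ↦ ((1 - |p.2| : ℝ) : ℂ) *
            Complex.exp (p.2 * (r * y : ℝ) * Complex.I)) (by fun_prop) hGc') (-1) 1
      simpa using (this.tendsto 0).mono_left nhdsWithin_le_nhds
    refine tendsto_nhds_unique hl (hr.congr' ?_)
    filter_upwards [self_mem_nhdsWithin] with δ hδ
    rw [max_eq_left (le_of_lt hδ)]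
    exact intervalIntegral_tent_mul_laplace hE hC hG hδ y
  have hRL := Real.tendsto_integral_exp_smul_cocompact
    (indicator (Ioc (-1 : ℝ) 1) fun t : ℝ ↦ ((1 - |t| : ℝ) : ℂ) * G ((r * t : ℝ) * Complex.I))
  have hlin : Tendsto (fun y : ℝ ↦ -(r * y) / (2 * Real.pi)) atTop (cocompact ℝ) := by
    refine Tendsto.mono_right ?_ atBot_le_cocompact
    refine (tendsto_neg_atTop_atBot.comp (tendsto_id.const_mul_atTop hr)).atBot_div_const
      (by positivity)
  have hlim := hRL.comp hlin
  have hre := (Complex.continuous_re.tendsto _).comp hlim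
  rw [Complex.zero_re] at hre
  refine hre.congr fun y ↦ ?_
  rw [← Complex.ofReal_re (∫ u in Ioi (0 : ℝ), E u * fejerKernel (r * (y - u))), hb,
    intervalIntegral.integral_of_le (by norm_num), ← integral_indicator measurableSet_Ioc]
  simp only [Function.comp_apply]
  congr 2
  ext t
  by_cases ht : t ∈ Ioc (-1 : ℝ) 1
  · simp only [indicator_of_mem ht, Circle.smul_def, Real.fourierChar_apply, smul_eq_mul]
    have h : 2 * Real.pi * -(t * (-(r * y) / (2 * Real.pi))) = t * (r * y) := by
      field_simp
    rw [h, Complex.ofReal_mul t]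
    ring
  · simp [indicator_of_notMem ht]

end Tauberian

section Tauberian

variable {A : ℝ → ℝ} {C r : ℝ}

lemma intervalIntegral_fejerKernel_comp (r c ε : ℝ) :
    r * ∫ u in (c - ε)..(c + ε), fejerKernel (r * (c - u)) =
      ∫ x in -(r * ε)..(r * ε), fejerKernel x := by
  have h1 := intervalIntegral.integral_comp_sub_left (fun v ↦ fejerKernel (r * v)) c
    (a := c - ε) (b := c + ε)
  rw [h1, intervalIntegral.mul_integral_comp_mul_left]
  congr 1 <;> ring

lemma tendsto_intervalIntegral_fejerKernel {ε : ℝ} (hε : 0 < ε) :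
    Tendsto (fun r ↦ ∫ x in -(r * ε)..(r * ε), fejerKernel x) atTop (𝓝 (∫ x, fejerKernel x)) := by
  have h := tendsto_id.atTop_mul_const hε
  exact intervalIntegral_tendsto_integral integrable_fejerKernel
    (tendsto_neg_atTop_atBot.comp h) h

lemma mul_integral_fejerKernel_comp (hr : 0 < r) (y : ℝ) :
    r * ∫ u, fejerKernel (r * (y - u)) = ∫ x, fejerKernel x := by
  rw [integral_sub_left_eq_self (fun v ↦ fejerKernel (r * v)) volume y,
    Measure.integral_comp_mul_left, abs_of_pos (inv_pos.mpr hr), smul_eq_mul,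
    mul_inv_cancel_left₀ hr.ne']

lemma tendsto_mul_setIntegral_fejerKernel (hr : 0 < r) :
    Tendsto (fun y ↦ r * ∫ u in Ioi (0 : ℝ), fejerKernel (r * (y - u))) atTop
      (𝓝 (∫ x, fejerKernel x)) := by
  refine tendsto_of_tendsto_of_tendsto_of_le_of_le' (tendsto_intervalIntegral_fejerKernel hr)
    tendsto_const_nhds ?_ ?_
  · filter_upwards [eventually_ge_atTop 0] with y hy
    rw [mul_comm y r, ← intervalIntegral_fejerKernel_comp r,
      intervalIntegral.integral_of_le (by linarith)]
    refine mul_le_mul_of_nonneg_left ?_ hr.le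
    refine setIntegral_mono_set (integrable_fejerKernel_comp hr.ne' y).integrableOn
      (Eventually.of_forall fun u ↦ fejerKernel_nonneg _) (Eventually.of_forall fun u hu ↦ ?_)
    exact lt_of_le_of_lt (by simp) hu.1
  · refine Eventually.of_forall fun y ↦ ?_
    rw [← mul_integral_fejerKernel_comp hr y]
    refine mul_le_mul_of_nonneg_left ?_ hr.le
    exact setIntegral_le_integral (integrable_fejerKernel_comp hr.ne' y)
      (Eventually.of_forall fun u ↦ fejerKernel_nonneg _)

lemma integrable_mul_fejerKernel_comp (hA : Measurable A) (hA0 : ∀ u, 0 ≤ A u)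
    (hAC : ∀ u, A u ≤ C) (hr : 0 < r) (y : ℝ) :
    Integrable fun u ↦ A u * fejerKernel (r * (y - u)) := by
  refine (integrable_fejerKernel_comp hr.ne' y).bdd_mul (c := C) hA.aestronglyMeasurable
    (Eventually.of_forall fun u ↦ ?_)
  rw [Real.norm_of_nonneg (hA0 u)]
  exact hAC u

lemma mul_intervalIntegral_fejerKernel_le (hA : Measurable A) (hA0 : ∀ u, 0 ≤ A u)
    (hAC : ∀ u, A u ≤ C) (hslow : ∀ u v, u ≤ v → A u * Real.exp (u - v) ≤ A v)
    (hr : 0 < r) {ε y : ℝ} (hε : 0 ≤ ε) (hy : 0 ≤ y) :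
    A y * Real.exp (-(2 * ε)) * ∫ x in -(r * ε)..(r * ε), fejerKernel x ≤
      r * ∫ u in Ioi (0 : ℝ), A u * fejerKernel (r * (y + ε - u)) := by
  rw [← intervalIntegral_fejerKernel_comp r (y + ε), mul_left_comm]
  gcongr
  rw [intervalIntegral.integral_of_le (by linarith), ← integral_const_mul]
  have hi := integrable_mul_fejerKernel_comp hA hA0 hAC hr (y + ε)
  calc _ ≤ ∫ u in Ioc (y + ε - ε) (y + ε + ε), A u * fejerKernel (r * (y + ε - u)) := by
        refine setIntegral_mono_on
          ((integrable_fejerKernel_comp hr.ne' _).const_mul _).integrableOn hi.integrableOn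
          measurableSet_Ioc fun u hu ↦ ?_
        refine mul_le_mul_of_nonneg_right ?_ (fejerKernel_nonneg _)
        refine le_trans ?_ (hslow y u (by linarith [hu.1]))
        exact mul_le_mul_of_nonneg_left (Real.exp_le_exp.mpr (by linarith [hu.2])) (hA0 y)
    _ ≤ _ := by
        refine setIntegral_mono_set hi.integrableOn
          (Eventually.of_forall fun u ↦ mul_nonneg (hA0 u) (fejerKernel_nonneg _))
          (Eventually.of_forall fun u hu ↦ ?_)
        exact lt_of_le_of_lt (by linarith) hu.1

lemma mul_integral_mul_fejerKernel_le (hA : Measurable A) (hA0 : ∀ u, 0 ≤ A u)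
    (hAC : ∀ u, A u ≤ C) (hslow : ∀ u v, u ≤ v → A u * Real.exp (u - v) ≤ A v)
    (hr : 0 < r) {ε y : ℝ} (hε : 0 ≤ ε) :
    r * ∫ u in Ioi (0 : ℝ), A u * fejerKernel (r * (y - ε - u)) ≤
      A y * Real.exp (2 * ε) * (∫ x in -(r * ε)..(r * ε), fejerKernel x) +
        C * ((∫ x, fejerKernel x) - ∫ x in -(r * ε)..(r * ε), fejerKernel x) := by
  set c := y - ε with hc
  have hK := integrable_fejerKernel_comp hr.ne' c
  have hi := integrable_mul_fejerKernel_comp hA hA0 hAC hr c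
  have hind : Integrable (indicator (Ioc (c - ε) (c + ε)) fun u ↦
      (A y * Real.exp (2 * ε) - C) * fejerKernel (r * (c - u))) :=
    (hK.const_mul _).indicator measurableSet_Ioc
  have h1 : ∫ u in Ioi (0 : ℝ), A u * fejerKernel (r * (c - u)) ≤
      ∫ u, A u * fejerKernel (r * (c - u)) :=
    setIntegral_le_integral hi (Eventually.of_forall fun u ↦
      mul_nonneg (hA0 u) (fejerKernel_nonneg _))
  have h2 : ∫ u, A u * fejerKernel (r * (c - u)) ≤
      ∫ u, (C * fejerKernel (r * (c - u)) + indicator (Ioc (c - ε) (c + ε)) (fun u ↦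
        (A y * Real.exp (2 * ε) - C) * fejerKernel (r * (c - u))) u) := by
    refine integral_mono hi ((hK.const_mul C).add hind) fun u ↦ ?_
    simp only
    by_cases hu : u ∈ Ioc (c - ε) (c + ε)
    · rw [indicator_of_mem hu, ← add_mul, add_sub_cancel]
      refine mul_le_mul_of_nonneg_right ?_ (fejerKernel_nonneg _)
      have h := hslow u y (by linarith [hu.2])
      calc A u = A u * Real.exp (u - y) * Real.exp (y - u) := by
            rw [mul_assoc, ← Real.exp_add]; simp
        _ ≤ A y * Real.exp (2 * ε) := by
            gcongr
            · exact hA0 y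
            · linarith [hu.1]
    · rw [indicator_of_notMem hu, add_zero]
      exact mul_le_mul_of_nonneg_right (hAC u) (fejerKernel_nonneg _)
  rw [integral_add (hK.const_mul C) hind, integral_const_mul, integral_indicator measurableSet_Ioc,
    integral_const_mul, ← intervalIntegral.integral_of_le (by linarith)] at h2
  rw [← intervalIntegral_fejerKernel_comp r c, ← mul_integral_fejerKernel_comp hr c]
  have h3 := mul_le_mul_of_nonneg_left (h1.trans h2) hr.le
  linarith

/-- A bounded slowly decreasing function whose Fejér averages tend to those of `1` tends to `1`. -/
lemma tendsto_one_of_tendsto_fejerKernel (hA : Measurable A) (hA0 : ∀ u, 0 ≤ A u)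
    (hAC : ∀ u, A u ≤ C) (hslow : ∀ u v, u ≤ v → A u * Real.exp (u - v) ≤ A v)
    (hlim : ∀ r : ℝ, 0 < r → Tendsto
      (fun y ↦ ∫ u in Ioi (0 : ℝ), (A u - 1) * fejerKernel (r * (y - u))) atTop (𝓝 0)) :
    Tendsto A atTop (𝓝 1) := by
  have hI := integral_fejerKernel_pos
  have hJ : ∀ r : ℝ, 0 < r → Tendsto
      (fun y ↦ r * ∫ u in Ioi (0 : ℝ), A u * fejerKernel (r * (y - u))) atTop
      (𝓝 (∫ x, fejerKernel x)) := by
    intro r hr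
    have h := ((hlim r hr).const_mul r).add (tendsto_mul_setIntegral_fejerKernel hr)
    rw [mul_zero, zero_add] at h
    refine h.congr fun y ↦ ?_
    have hK := (integrable_fejerKernel_comp hr.ne' y).integrableOn (s := Ioi 0)
    have hi := (integrable_mul_fejerKernel_comp hA hA0 hAC hr y).integrableOn (s := Ioi 0)
    simp only [sub_mul, one_mul]
    rw [integral_sub hi hK]
    ring
  refine tendsto_order.2 ⟨fun b hb ↦ ?_, fun b hb ↦ ?_⟩
  · obtain ⟨ε, hεb, hε⟩ : ∃ ε : ℝ, b * Real.exp (2 * ε) < 1 ∧ 0 < ε := by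
      have hc : Continuous fun ε : ℝ ↦ b * Real.exp (2 * ε) := by fun_prop
      have := (hc.tendsto 0).eventually (gt_mem_nhds (by simpa using hb))
      exact ((this.filter_mono nhdsWithin_le_nhds).and
        (self_mem_nhdsWithin (s := Ioi (0 : ℝ)))).exists
    have hΦ := tendsto_intervalIntegral_fejerKernel hε
    have hl := (hΦ.const_mul (b * Real.exp (2 * ε))).add
      ((hΦ.const_sub (∫ x, fejerKernel x)).const_mul C)
    rw [sub_self, mul_zero, add_zero] at hl
    obtain ⟨r, hr1, hr⟩ := ((hl.eventually (gt_mem_nhds (mul_lt_of_lt_one_left hI hεb))).and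
      (eventually_gt_atTop 0)).exists
    have hsub : Tendsto (fun y : ℝ ↦ y - ε) atTop atTop :=
      tendsto_atTop_add_const_right _ _ tendsto_id
    filter_upwards [((hJ r hr).comp hsub).eventually (lt_mem_nhds hr1)] with y hy
    have h := hy.trans_le (mul_integral_mul_fejerKernel_le hA hA0 hAC hslow hr hε.le)
    have h2 := lt_of_add_lt_add_right h
    have hΦ0 : 0 ≤ ∫ x in -(r * ε)..(r * ε), fejerKernel x :=
      intervalIntegral.integral_nonneg (by nlinarith) fun x _ ↦ fejerKernel_nonneg x
    exact lt_of_mul_lt_mul_right (lt_of_mul_lt_mul_right h2 hΦ0) (Real.exp_pos _).le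
  · obtain ⟨ε, hεb, hε⟩ : ∃ ε : ℝ, 1 < b * Real.exp (-(2 * ε)) ∧ 0 < ε := by
      have hc : Continuous fun ε : ℝ ↦ b * Real.exp (-(2 * ε)) := by fun_prop
      have := (hc.tendsto 0).eventually (lt_mem_nhds (by simpa using hb))
      exact ((this.filter_mono nhdsWithin_le_nhds).and
        (self_mem_nhdsWithin (s := Ioi (0 : ℝ)))).exists
    have hl := (tendsto_intervalIntegral_fejerKernel hε).const_mul (b * Real.exp (-(2 * ε)))
    obtain ⟨r, hr1, hr⟩ := ((hl.eventually (lt_mem_nhds (a := ∫ x, fejerKernel x)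
      (lt_mul_of_one_lt_left hI hεb))).and (eventually_gt_atTop 0)).exists
    have hadd : Tendsto (fun y : ℝ ↦ y + ε) atTop atTop :=
      tendsto_atTop_add_const_right _ _ tendsto_id
    filter_upwards [((hJ r hr).comp hadd).eventually (gt_mem_nhds hr1), eventually_ge_atTop 0]
      with y hy hy0
    have h := (mul_intervalIntegral_fejerKernel_le hA hA0 hAC hslow hr hε.le hy0).trans_lt hy
    have hΦ0 : 0 ≤ ∫ x in -(r * ε)..(r * ε), fejerKernel x :=
      intervalIntegral.integral_nonneg (by nlinarith) fun x _ ↦ fejerKernel_nonneg x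
    exact lt_of_mul_lt_mul_right (lt_of_mul_lt_mul_right h hΦ0) (Real.exp_pos _).le

end Tauberian

lemma tendsto_psiExp : Tendsto psiExp atTop (𝓝 1) := by
  refine tendsto_one_of_tendsto_fejerKernel measurable_psiExp psiExp_nonneg psiExp_le
    (fun u v h ↦ psiExp_mul_exp_le h) fun r hr ↦ ?_
  refine tendsto_integral_mul_fejerKernel (E := fun u ↦ psiExp u - 1) (C := Real.log 4 + 4)
    (measurable_psiExp.sub_const 1) (fun u _ ↦ ?_)
    (fun z hz ↦ integral_psiExp_sub_one_mul_exp hz) continuousOn_psiLaplace hr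
  have := Real.log_pos (show (1 : ℝ) < 4 by norm_num)
  rw [abs_le]
  constructor <;> linarith [psiExp_nonneg u, psiExp_le u]

lemma tendsto_psi_div : Tendsto (fun x ↦ Chebyshev.psi x / x) atTop (𝓝 1) := by
  refine (tendsto_psiExp.comp Real.tendsto_log_atTop).congr' ?_
  filter_upwards [eventually_gt_atTop 0] with x hx
  simp [psiExp, Real.exp_neg, Real.exp_log hx, div_eq_mul_inv]

lemma tendsto_theta_div : Tendsto (fun x ↦ Chebyshev.theta x / x) atTop (𝓝 1) := by
  have h1 : Tendsto (fun x ↦ (Chebyshev.psi x - Chebyshev.theta x) / x) atTop (𝓝 0) := by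
    refine Asymptotics.IsLittleO.tendsto_div_nhds_zero
      (Chebyshev.isBigO_psi_sub_theta_sqrt.trans_isLittleO ?_)
    refine Asymptotics.isLittleO_of_tendsto (fun x hx ↦ by simp [hx]) ?_
    simp only [Real.sqrt_div_self]
    exact (tendsto_inv_atTop_zero.comp Real.tendsto_sqrt_atTop).congr fun x ↦ by simp
  have h2 := tendsto_psi_div.sub h1
  rw [sub_zero] at h2
  refine h2.congr fun x ↦ ?_
  rw [← sub_div, sub_sub_cancel]

/-- The prime number theorem. -/
lemma tendsto_primeCounting_mul_log_div :
    Tendsto (fun x : ℝ ↦ (Nat.primeCounting ⌊x⌋₊ : ℝ) * Real.log x / x) atTop (𝓝 1) := by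
  have h1 : Tendsto (fun x : ℝ ↦
      ((Nat.primeCounting ⌊x⌋₊ : ℝ) - Chebyshev.theta x / Real.log x) / (x / Real.log x))
      atTop (𝓝 0) := by
    refine Asymptotics.IsLittleO.tendsto_div_nhds_zero
      (Chebyshev.primeCounting_sub_theta_div_log_isBigO.trans_isLittleO ?_)
    refine Asymptotics.isLittleO_of_tendsto' ?_ ?_
    · filter_upwards [eventually_gt_atTop 1] with x hx h
      have := Real.log_pos hx
      have : x / Real.log x > 0 := by positivity
      exact absurd h this.ne'
    · have h : Tendsto (fun x ↦ (Real.log x)⁻¹) atTop (𝓝 0) :=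
        Real.tendsto_log_atTop.inv_tendsto_atTop
      refine h.congr' ?_
      filter_upwards [eventually_gt_atTop 1] with x hx
      have := Real.log_pos hx
      field_simp
  have h2 := h1.add tendsto_theta_div
  rw [zero_add] at h2
  refine h2.congr' ?_
  filter_upwards [eventually_gt_atTop 1] with x hx
  have := Real.log_pos hx
  field_simp
  ring

lemma exists_primeCounting_mul_log_div_le :
    ∃ C : ℝ, 0 ≤ C ∧ ∀ y : ℝ, 0 < y → (Nat.primeCounting ⌊y⌋₊ : ℝ) * Real.log y / y ≤ C := by
  refine ⟨2 * Real.log 4 + 2, by positivity, fun y hy ↦ ?_⟩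
  rw [div_le_iff₀ hy]
  rcases le_or_gt y 1 with h | h
  · have := Real.log_nonpos hy.le h
    have h2 : (Nat.primeCounting ⌊y⌋₊ : ℝ) * Real.log y ≤ 0 :=
      mul_nonpos_of_nonneg_of_nonpos (by positivity) this
    exact h2.trans (by positivity)
  · have hl := Real.log_pos h
    have h1 := Chebyshev.pi_le_log4_mul_div h
    rw [Real.log_sqrt hy.le] at h1
    have h2 : Real.log y ≤ 2 * √y := by
      have := Real.log_le_sub_one_of_pos (Real.sqrt_pos.mpr hy)
      rw [Real.log_sqrt hy.le] at this
      linarith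
    calc _ ≤ (Real.log 4 * y / (Real.log y / 2) + √y) * Real.log y := by gcongr
      _ = 2 * Real.log 4 * y + √y * Real.log y := by field_simp
      _ ≤ 2 * Real.log 4 * y + √y * (2 * √y) := by gcongr
      _ = _ := by rw [mul_left_comm, Real.mul_self_sqrt hy.le]; ring

lemma primeCounting_floor_le {y : ℝ} (hy : 0 ≤ y) : (Nat.primeCounting ⌊y⌋₊ : ℝ) ≤ y := by
  refine le_trans ?_ (Nat.floor_le hy)
  rw [Nat.primeCounting, Nat.primeCounting', Nat.count_eq_card_filter_range, Nat.cast_le]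
  calc _ ≤ (Finset.Ioc 0 ⌊y⌋₊).card := by
        refine Finset.card_le_card fun k hk ↦ ?_
        rw [Finset.mem_filter, Finset.mem_range] at hk
        exact Finset.mem_Ioc.mpr ⟨hk.2.pos, by omega⟩
    _ = _ := by simp

lemma sum_Icc_ite_prime (n : ℕ) :
    ∑ k ∈ Finset.Icc 0 n, (if k.Prime then (1 : ℝ) else 0) = Nat.primeCounting n := by
  rw [Finset.sum_ite, Finset.sum_const_zero, add_zero, Finset.sum_const, nsmul_one,
    Nat.primeCounting, Nat.primeCounting', Nat.count_eq_card_filter_range]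
  congr 3
  ext; simp

section Profile

variable {σ : ℝ}

noncomputable def primeWeight (σ s : ℝ) : ℝ := σ * (1 - s ^ σ / (2 - s ^ σ))

lemma rpow_mem_Icc {s : ℝ} (hσ : 0 < σ) (hs : s ∈ Icc (0 : ℝ) 1) : s ^ σ ∈ Icc (0 : ℝ) 1 :=
  ⟨Real.rpow_nonneg hs.1 _, Real.rpow_le_one hs.1 hs.2 hσ.le⟩

lemma primeWeight_mem_Icc {s : ℝ} (hσ : 0 < σ) (hs : s ∈ Icc (0 : ℝ) 1) :
    primeWeight σ s ∈ Icc 0 σ := by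
  obtain ⟨h0, h1⟩ := rpow_mem_Icc hσ hs
  have h2 : s ^ σ / (2 - s ^ σ) ≤ 1 := by rw [div_le_one (by linarith)]; linarith
  have h3 : 0 ≤ s ^ σ / (2 - s ^ σ) := div_nonneg h0 (by linarith)
  unfold primeWeight
  constructor <;> nlinarith

lemma continuousOn_rpow_div (hσ : 0 < σ) :
    ContinuousOn (fun s : ℝ ↦ s ^ σ / (2 - s ^ σ)) (Icc 0 1) := by
  have h : ContinuousOn (fun s : ℝ ↦ s ^ σ) (Icc 0 1) :=
    (Real.continuous_rpow_const hσ.le).continuousOn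
  exact h.div (continuousOn_const.sub h) fun s hs ↦ by linarith [(rpow_mem_Icc hσ hs).2]

lemma continuousOn_primeWeight (hσ : 0 < σ) : ContinuousOn (primeWeight σ) (Icc 0 1) :=
  continuousOn_const.mul (continuousOn_const.sub (continuousOn_rpow_div hσ))

lemma integral_primeWeight (hσ : 0 < σ) :
    ∫ s in (0 : ℝ)..1, primeWeight σ s = σ * (1 - ∫ t in (0 : ℝ)..1, t ^ σ / (2 - t ^ σ)) := by
  unfold primeWeight
  rw [intervalIntegral.integral_const_mul, intervalIntegral.integral_sub (by simp)]
  · simp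
  · exact ContinuousOn.intervalIntegrable (by simpa using continuousOn_rpow_div hσ)

lemma hasDerivAt_neg_log_one_sub {X t : ℝ} (hσ : 0 < σ) (ht : 0 < t) (htX : t ≤ X) :
    HasDerivAt (fun t ↦ -Real.log (1 - (1 - (t / X) ^ σ) ^ 2))
      (-(primeWeight σ (t / X) / t)) t := by
  have hX := ht.trans_le htX
  have hs : 0 < t / X := by positivity
  have hs1 : t / X ≤ 1 := (div_le_one hX).mpr htX
  have h1 := (rpow_mem_Icc hσ ⟨hs.le, hs1⟩).2
  have h0 := Real.rpow_pos_of_pos hs σ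
  have hr : HasDerivAt (fun t ↦ (t / X) ^ σ) (1 / X * σ * (t / X) ^ (σ - 1)) t :=
    ((hasDerivAt_id t).div_const X).rpow_const (Or.inl hs.ne')
  have hne : 1 - (1 - (t / X) ^ σ) ^ 2 ≠ 0 := by nlinarith
  have h := ((((hr.const_sub 1).pow 2).const_sub 1).log hne).neg
  refine h.congr_deriv ?_
  rw [Real.rpow_sub_one hs.ne', primeWeight]
  set w := (t / X) ^ σ
  have hw : 1 - ((fun x : ℝ ↦ 1 - (x / X) ^ σ) ^ 2) t = w * (2 - w) := by
    simp only [Pi.pow_apply]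
    ring
  have h2 : 2 - w ≠ 0 := by linarith
  rw [hw]
  field_simp
  ring

lemma sum_primes_eq_integral {X : ℝ} (hσ : 0 < σ) (hX : 2 ≤ X) :
    ∑ p ∈ (Finset.Iic ⌊X⌋₊).filter Nat.Prime, -Real.log (1 - (1 - ((p : ℝ) / X) ^ σ) ^ 2) =
      ∫ t in Ioc 2 X, primeWeight σ (t / X) / t * Nat.primeCounting ⌊t⌋₊ := by
  have hd : ∀ t ∈ Icc 2 X, HasDerivAt (fun t ↦ -Real.log (1 - (1 - (t / X) ^ σ) ^ 2))
      (-(primeWeight σ (t / X) / t)) t := fun t ht ↦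
    hasDerivAt_neg_log_one_sub hσ (by linarith [ht.1]) ht.2
  have hcont : ContinuousOn (fun t ↦ -(primeWeight σ (t / X) / t)) (Icc 2 X) := by
    refine (ContinuousOn.div ?_ continuousOn_id fun t ht ↦ ?_).neg
    · refine (continuousOn_primeWeight hσ).comp (by fun_prop) fun t ht ↦ ?_
      exact ⟨div_nonneg (by linarith [ht.1]) (by linarith), (div_le_one (by linarith)).mpr ht.2⟩
    · exact (show (0 : ℝ) < t by linarith [ht.1]).ne'
  have h := sum_mul_eq_sub_integral_mul₁ (fun k ↦ if k.Prime then (1 : ℝ) else 0)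
    (by simp [Nat.not_prime_zero]) (by simp [Nat.not_prime_one]) X
    (fun t ht ↦ (hd t ht).differentiableAt)
    ((hcont.congr fun t ht ↦ (hd t ht).deriv).integrableOn_Icc)
  simp only [sum_Icc_ite_prime, mul_ite, mul_one, mul_zero] at h
  rw [← Finset.sum_filter] at h
  have hI : Finset.Iic ⌊X⌋₊ = Finset.Icc 0 ⌊X⌋₊ := by ext; simp
  rw [hI, h, div_self (by linarith), Real.one_rpow]
  simp only [sub_self, ne_eq, OfNat.ofNat_ne_zero, not_false_eq_true, zero_pow, sub_zero,
    Real.log_one, neg_zero, zero_mul, zero_sub]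
  rw [← integral_neg]
  refine setIntegral_congr_fun measurableSet_Ioc fun t ht ↦ ?_
  rw [(hd t ⟨ht.1.le, ht.2⟩).deriv]
  ring

lemma integral_primeCounting_rescale {X : ℝ} (hX : 2 ≤ X) :
    ∫ t in Ioc 2 X, primeWeight σ (t / X) / t * Nat.primeCounting ⌊t⌋₊ =
      ∫ s in (0 : ℝ)..1, primeWeight σ s / s * Nat.primeCounting ⌊s * X⌋₊ := by
  have hX0 : 0 < X := by linarith
  have h0 : ∫ t in Ioc 2 X, primeWeight σ (t / X) / t * Nat.primeCounting ⌊t⌋₊ =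
      ∫ t in Ioc 0 X, primeWeight σ (t / X) / t * Nat.primeCounting ⌊t⌋₊ := by
    symm
    refine setIntegral_eq_of_subset_of_ae_sdiff_eq_zero measurableSet_Ioc.nullMeasurableSet
      (Ioc_subset_Ioc_left (by norm_num)) ?_
    have h2 : ∀ᵐ t : ℝ, t ≠ 2 := Measure.ae_ne volume 2
    filter_upwards [h2] with t ht2 ht
    have htX := ht.1.2
    have hlt : t < 2 := lt_of_le_of_ne (not_lt.mp fun h ↦ ht.2 ⟨h, htX⟩) ht2
    have : ⌊t⌋₊ < 2 := (Nat.floor_lt ht.1.1.le).mpr (by exact_mod_cast hlt)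
    have : Nat.primeCounting ⌊t⌋₊ = 0 := Nat.primeCounting_eq_zero_iff.mpr (by omega)
    simp [this]
  rw [h0, ← intervalIntegral.integral_of_le hX0.le]
  have h := intervalIntegral.mul_integral_comp_mul_right (a := 0) (b := 1) (f :=
    fun t ↦ primeWeight σ (t / X) / t * (Nat.primeCounting ⌊t⌋₊ : ℝ)) (c := X)
  rw [zero_mul, one_mul] at h
  rw [← h, ← intervalIntegral.integral_const_mul]
  refine intervalIntegral.integral_congr fun s _ ↦ ?_
  rw [mul_div_cancel_right₀ s hX0.ne']
  field_simp

lemma tendsto_integral_primeWeight (hσ : 0 < σ) :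
    Tendsto (fun X : ℝ ↦ ∫ s in (0 : ℝ)..1,
      primeWeight σ s * (Nat.primeCounting ⌊s * X⌋₊ * Real.log X / (s * X))) atTop
      (𝓝 (∫ s in (0 : ℝ)..1, primeWeight σ s)) := by
  obtain ⟨C, hC0, hC⟩ := exists_primeCounting_mul_log_div_le
  refine intervalIntegral.tendsto_integral_filter_of_dominated_convergence
    (fun s ↦ σ * (C + |Real.log s|)) ?_ ?_ ?_ ?_
  · refine Eventually.of_forall fun X ↦ ?_
    refine Measurable.aestronglyMeasurable ?_
    have h1 : Measurable (primeWeight σ) := by unfold primeWeight; fun_prop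
    have h2 : Measurable fun s : ℝ ↦ (Nat.primeCounting ⌊s * X⌋₊ : ℝ) :=
      (measurable_from_nat (f := fun n ↦ (Nat.primeCounting n : ℝ))).comp
        (Nat.measurable_floor.comp (measurable_id.mul_const X))
    fun_prop
  · filter_upwards [eventually_ge_atTop 1] with X hX
    refine Eventually.of_forall fun s hs ↦ ?_
    rw [uIoc_of_le zero_le_one] at hs
    have hs0 := hs.1
    have hX0 : 0 < X := by linarith
    have hsX : 0 < s * X := by positivity
    obtain ⟨hw0, hw1⟩ := primeWeight_mem_Icc hσ ⟨hs.1.le, hs.2⟩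
    have hlogX := Real.log_nonneg hX
    have hb0 : 0 ≤ (Nat.primeCounting ⌊s * X⌋₊ * Real.log X / (s * X) : ℝ) := by positivity
    rw [Real.norm_of_nonneg (mul_nonneg hw0 hb0)]
    refine mul_le_mul hw1 ?_ hb0 hσ.le
    have e : Real.log X = Real.log (s * X) - Real.log s := by
      rw [Real.log_mul hs0.ne' hX0.ne']; ring
    rw [e, mul_sub, sub_div, sub_eq_add_neg]
    refine add_le_add (hC _ hsX) ?_
    rw [mul_comm, mul_div_assoc, ← neg_mul, ← abs_of_nonpos (Real.log_nonpos hs0.le hs.2)]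
    refine mul_le_of_le_one_right (abs_nonneg _) ?_
    rw [div_le_one hsX]
    exact primeCounting_floor_le hsX.le
  · exact (intervalIntegrable_const.add intervalIntegral.intervalIntegrable_log'.abs).const_mul σ
  · refine Eventually.of_forall fun s hs ↦ ?_
    rw [uIoc_of_le zero_le_one] at hs
    have hs0 := hs.1
    have hsX : Tendsto (fun X ↦ s * X) atTop atTop := tendsto_id.const_mul_atTop hs0
    have h1 := tendsto_primeCounting_mul_log_div.comp hsX
    have h2 : Tendsto (fun X ↦ 1 + -Real.log s / Real.log (s * X)) atTop (𝓝 (1 + 0)) :=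
      tendsto_const_nhds.add ((Real.tendsto_log_atTop.comp hsX).const_div_atTop _)
    have h3 := (h1.mul h2).const_mul (primeWeight σ s)
    rw [add_zero, mul_one, mul_one] at h3
    refine h3.congr' ?_
    filter_upwards [hsX.eventually_gt_atTop 1, eventually_gt_atTop 0] with X hX hX0
    have hl := Real.log_pos hX
    have e : Real.log X = Real.log (s * X) - Real.log s := by
      rw [Real.log_mul hs0.ne' hX0.ne']; ring
    simp only [Function.comp_apply]
    rw [e]
    field_simp
    ring

end Profile

end

/-- For fixed `σ ∈ (1/2, 1)`, with `λ(σ) = ∫₀¹ t^σ/(2 - t^σ) dt` and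
`r(p) = 1 - (p/X)^σ` for primes `p ≤ X`, as `X → ∞`,
`∑_{p ≤ X prime} (-log(1 - r(p)²)) = (σ(1 - λ(σ)) + o(1)) X / log X`. -/
theorem resonator_second_moment_asymptotic (σ : ℝ) (hσ : σ ∈ Set.Ioo (1/2 : ℝ) 1) :
    Filter.Tendsto
      (fun X : ℝ =>
        (∑ p ∈ (Finset.Iic ⌊X⌋₊).filter Nat.Prime,
            -Real.log (1 - (1 - ((p : ℝ) / X) ^ σ) ^ 2)) /
          (X / Real.log X))
      Filter.atTop
      (nhds (σ * (1 - ∫ t in (0:ℝ)..1, t ^ σ / (2 - t ^ σ)))) := by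
  have hσ0 : 0 < σ := by linarith [hσ.1]
  rw [← integral_primeWeight hσ0]
  refine (tendsto_integral_primeWeight hσ0).congr' ?_
  filter_upwards [Filter.eventually_ge_atTop 2] with X hX
  rw [sum_primes_eq_integral hσ0 hX, integral_primeCounting_rescale hX,
    ← intervalIntegral.integral_div]
  refine intervalIntegral.integral_congr fun s _ ↦ ?_
  have := Real.log_pos (show 1 < X by linarith)
  field_simp
end
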